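/- Let K = 68042. For every δ > 0, every integer ℓ ≥ 4 and every α ∈ (0, 1/(60ℓ(K+2))], there exists ε₀ > 0 such that for all ε ∈ (0, ε₀) there is n₀ ∈ ℕ such that the following holds for all n ≥ n₀. Let G be a (p,λ)-bijumbled graph on n vertices with p ∈ (0, 1/3], λ ≤ ε p² n and minimum degree δ(G) ≥ δ p n, and set m = αn. Then G contains an absorbing structure S = (T, P₁, A, P₂, Z, Z₁) for cycles of length ℓ with flexibility m, where the template T has maximum degree at most K; moreover, there exists a set W ⊆ V(G) ∖ V(S) with |W| = n/4 such that deg(v, W) ≥ δ p |W| / 8 for every vertex v of G. -/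

import Mathlib

open Finset

/-- The number of pairs `(a,b) ∈ A × B` with `ab` an edge of `G`
(edges inside `A ∩ B` are counted twice). -/
def ePairs {V : Type} [DecidableEq V] (G : SimpleGraph V) [DecidableRel G.Adj]
    (A B : Finset V) : ℕ :=
  ((A ×ˢ B).filter fun ab => G.Adj ab.1 ab.2).card

/-- `G` is `(p,λ)`-bijumbled: `|e(A,B) − p|A||B|| < λ√(|A||B|)` for all (nonempty)
vertex subsets `A, B`. -/
def Bijumbled {V : Type} [Fintype V] [DecidableEq V] (G : SimpleGraph V)
    [DecidableRel G.Adj] (p lam : ℝ) : Prop :=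
  ∀ A B : Finset V, A.Nonempty → B.Nonempty →
    |(ePairs G A B : ℝ) - p * A.card * B.card| < lam * Real.sqrt (A.card * B.card)

/-- `degIn G v U` is the number of neighbours of `v` in `U`, i.e. `|N_G(v) ∩ U|`. -/
def degIn {V : Type} [DecidableEq V] (G : SimpleGraph V) [DecidableRel G.Adj]
    (v : V) (U : Finset V) : ℕ :=
  (U.filter fun u => G.Adj v u).card

/-- An absorbing structure in `G` for cycles of length `s + 2` with flexibility `m`.
The template `T` is a bipartite graph with parts `I = Fin (3m)` and `J = Fin (4m)`
(its flexible set `J₁` being `{j | (j : ℕ) < 2m}`), such that removing any `m` flexible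
vertices leaves a graph with a perfect matching. `P₁ = {P¹,…,P^{3m}}` and
`P₂ = {P_{ij} : (i,j) ∈ E(T)}` are families of pairwise vertex-disjoint paths of length
`s` in `G`, `A = {a_{ij}}` and `Z = {z₁,…,z_{4m}}` are sets of distinct vertices, the
vertex sets `V(P₁), V(P₂), A, Z` are pairwise disjoint, and for every `(i,j) ∈ E(T)`,
`a_{ij}` is adjacent to both ends of `Pⁱ` and of `P_{ij}`, and `z_j` is adjacent to both
ends of `P_{ij}`. -/
structure AbsorbingStructure {V : Type} [Fintype V] [DecidableEq V] (G : SimpleGraph V)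
    (s m : ℕ) where
  /-- The edge set of the template. -/
  T : Finset (Fin (3 * m) × Fin (4 * m))
  /-- The template property: removing any `m` vertices of the flexible set `J₁` leaves
  a graph with a perfect matching. -/
  template : ∀ Jbar : Finset (Fin (4 * m)),
    (∀ j ∈ Jbar, (j : ℕ) < 2 * m) → Jbar.card = m →
    ∃ f : Fin (3 * m) → Fin (4 * m), Function.Injective f ∧
      ∀ i, (i, f i) ∈ T ∧ f i ∉ Jbar
  /-- The left endpoints of the paths `Pⁱ`. -/
  pA : Fin (3 * m) → V
  /-- The right endpoints of the paths `Pⁱ`. -/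
  pB : Fin (3 * m) → V
  /-- The paths `P¹, …, P^{3m}` of `P₁`. -/
  P1 : ∀ i, G.Walk (pA i) (pB i)
  P1_path : ∀ i, (P1 i).IsPath
  P1_len : ∀ i, (P1 i).length = s
  /-- The left endpoints of the paths `P_{ij}`. -/
  qA : Fin (3 * m) × Fin (4 * m) → V
  /-- The right endpoints of the paths `P_{ij}`. -/
  qB : Fin (3 * m) × Fin (4 * m) → V
  /-- The paths `P_{ij}`, `(i,j) ∈ E(T)`, of `P₂`. -/
  P2 : ∀ e, G.Walk (qA e) (qB e)
  P2_path : ∀ e ∈ T, (P2 e).IsPath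
  P2_len : ∀ e ∈ T, (P2 e).length = s
  /-- The vertices `a_{ij}`, `(i,j) ∈ E(T)`. -/
  a : Fin (3 * m) × Fin (4 * m) → V
  /-- The vertices `z₁, …, z_{4m}`. -/
  z : Fin (4 * m) → V
  P1_disj : ∀ i j, i ≠ j →
    Disjoint (P1 i).support.toFinset (P1 j).support.toFinset
  P2_disj : ∀ e ∈ T, ∀ e' ∈ T, e ≠ e' →
    Disjoint (P2 e).support.toFinset (P2 e').support.toFinset
  a_inj : ∀ e ∈ T, ∀ e' ∈ T, a e = a e' → e = e'
  z_inj : Function.Injective z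
  /-- The vertex sets `V(P₁)`, `V(P₂)`, `A` and `Z` are pairwise disjoint. -/
  global_disj : List.Pairwise Disjoint
    [Finset.univ.biUnion (fun i => (P1 i).support.toFinset),
     T.biUnion (fun e => (P2 e).support.toFinset),
     T.image a,
     Finset.univ.image z]
  adj_a_P1 : ∀ e ∈ T, G.Adj (a e) (pA e.1) ∧ G.Adj (a e) (pB e.1)
  adj_a_P2 : ∀ e ∈ T, G.Adj (a e) (qA e) ∧ G.Adj (a e) (qB e)
  adj_z_P2 : ∀ e ∈ T, G.Adj (z e.2) (qA e) ∧ G.Adj (z e.2) (qB e)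

/-- The vertex set `V(S)` of an absorbing structure: all vertices of the paths of `P₁`
and `P₂` together with `A` and `Z`. -/
def AbsorbingStructure.verts {V : Type} [Fintype V] [DecidableEq V] {G : SimpleGraph V}
    {s m : ℕ} (S : AbsorbingStructure G s m) : Finset V :=
  Finset.univ.biUnion (fun i => (S.P1 i).support.toFinset) ∪
    S.T.biUnion (fun e => (S.P2 e).support.toFinset) ∪
    S.T.image S.a ∪ Finset.univ.image S.z

/-- The permutations mapping `S` into `T`. -/
def permsInto {X : Type*} [Fintype X] [DecidableEq X] (S T : Finset X) :
    Finset (Equiv.Perm X) :=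
  univ.filter fun σ => ∀ x ∈ S, σ x ∈ T

lemma card_permsInto_insert_eq {X : Type*} [Fintype X] [DecidableEq X] (S T : Finset X)
    {x y : X} (hx : x ∉ S) (hy : y ∉ S) :
    (permsInto (insert x S) T).card = (permsInto (insert y S) T).card := by
  refine Finset.card_bij' (fun σ _ => (Equiv.swap x y).trans σ)
    (fun σ _ => (Equiv.swap x y).trans σ) ?_ ?_ ?_ ?_
  · intro σ hσ
    simp only [permsInto, mem_filter, mem_univ, true_and, forall_mem_insert,
      Equiv.trans_apply, Equiv.swap_apply_right] at hσ ⊢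
    refine ⟨hσ.1, fun z hz => ?_⟩
    rw [Equiv.swap_apply_of_ne_of_ne (by grind) (by grind)]
    exact hσ.2 z hz
  · intro σ hσ
    simp only [permsInto, mem_filter, mem_univ, true_and, forall_mem_insert,
      Equiv.trans_apply, Equiv.swap_apply_left] at hσ ⊢
    refine ⟨hσ.1, fun z hz => ?_⟩
    rw [Equiv.swap_apply_of_ne_of_ne (by grind) (by grind)]
    exact hσ.2 z hz
  · intro σ _; ext z; simp
  · intro σ _; ext z; simp

lemma card_permsInto_insert {X : Type*} [Fintype X] [DecidableEq X] (S T : Finset X)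
    {x : X} (hx : x ∉ S) :
    (Fintype.card X - S.card) * (permsInto (insert x S) T).card =
      (permsInto S T).card * (T.card - S.card) := by
  have h1 : ∑ y ∈ Sᶜ, (permsInto (insert y S) T).card =
      (Fintype.card X - S.card) * (permsInto (insert x S) T).card := by
    rw [← card_compl, ← smul_eq_mul, ← sum_const]
    exact sum_congr rfl fun y hy => card_permsInto_insert_eq S T (by simpa using hy) hx
  rw [← h1]
  have h2 : ∀ y, (permsInto (insert y S) T).card =
      ∑ σ ∈ permsInto S T, if σ y ∈ T then 1 else 0 := by
    intro y
    rw [← card_filter]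
    congr 1
    ext σ
    simp [permsInto, and_comm]
  simp_rw [h2]
  rw [sum_comm, ← smul_eq_mul, ← sum_const]
  refine sum_congr rfl fun σ hσ => ?_
  rw [← card_filter]
  have h3 : (Sᶜ.filter fun y => σ y ∈ T) = T.map σ.symm.toEmbedding \ S := by
    ext y; simp [and_comm]
  rw [h3, card_sdiff_of_subset, card_map]
  intro y hy
  simp only [permsInto, mem_filter, mem_univ, true_and] at hσ
  simpa using hσ y hy

lemma card_permsInto_mul_le {X : Type*} [Fintype X] [DecidableEq X] (S T : Finset X) :
    (permsInto S T).card * Fintype.card X ^ S.card ≤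
      T.card ^ S.card * (Fintype.card X).factorial := by
  induction S using Finset.induction_on with
  | empty => simp [permsInto, Fintype.card_perm]
  | insert x S hx ih =>
    have h := card_permsInto_insert S T hx
    have hS : S.card < Fintype.card X := by
      have := card_le_univ (insert x S)
      rwa [card_insert_of_notMem hx] at this
    have hT : T.card ≤ Fintype.card X := card_le_univ _
    have key : (permsInto (insert x S) T).card * Fintype.card X ≤
        (permsInto S T).card * T.card := by
      obtain ⟨r, hr⟩ := Nat.exists_eq_add_of_lt hS
      have hr' : Fintype.card X - S.card = r + 1 := by omega
      rw [hr'] at h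
      refine Nat.le_of_mul_le_mul_left ?_ (Nat.succ_pos r)
      calc (r + 1) * ((permsInto (insert x S) T).card * Fintype.card X)
          = (permsInto S T).card * ((T.card - S.card) * Fintype.card X) := by
            rw [← mul_assoc, h, mul_assoc]
        _ ≤ (permsInto S T).card * ((r + 1) * T.card) := by
            refine Nat.mul_le_mul_left _ ?_
            rcases le_total T.card S.card with h' | h'
            · simp [Nat.sub_eq_zero_of_le h']
            · obtain ⟨q, hq⟩ := Nat.exists_eq_add_of_le h'
              have : T.card - S.card = q := by omega
              rw [this, hq, hr]
              have : q ≤ r + 1 := by omega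
              nlinarith
        _ = _ := by rw [Nat.succ_eq_add_one]; ring
    rw [card_insert_of_notMem hx, pow_succ, pow_succ]
    calc _ = ((permsInto (insert x S) T).card * Fintype.card X) * Fintype.card X ^ S.card := by
          ring
      _ ≤ ((permsInto S T).card * T.card) * Fintype.card X ^ S.card := by gcongr
      _ = ((permsInto S T).card * Fintype.card X ^ S.card) * T.card := by ring
      _ ≤ (T.card ^ S.card * (Fintype.card X).factorial) * T.card := by gcongr
      _ = _ := by ring

/-- The union bound estimate behind the existence of bounded degree expanders. -/
lemma choose_mul_choose_mul_pow_le {b s : ℕ} (hs : 1 ≤ s) (hsb : 4 * s ≤ 3 * b) :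
    ((2 * b).choose s : ℝ) * b.choose s * ((s / b : ℝ) ^ s) ^ 20 ≤ (1 / 4) ^ s := by
  have hs0 : (0 : ℝ) < s := by exact_mod_cast hs
  have hb0 : (0 : ℝ) < b := by exact_mod_cast (by omega : 0 < b)
  have hfac : (s : ℝ) ^ s / s.factorial ≤ 3 ^ s := by
    refine (Real.pow_div_factorial_le_exp _ hs0.le s).trans ?_
    rw [← Real.exp_one_pow]
    gcongr
    exact Real.exp_one_lt_three.le
  have hch : ∀ N : ℕ, (N.choose s : ℝ) ≤ (3 * N / s) ^ s := by
    intro N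
    refine (Nat.choose_le_pow_div s N).trans ?_
    rw [mul_div_assoc, mul_pow, div_pow]
    have : (N : ℝ) ^ s / s.factorial = (s : ℝ) ^ s / s.factorial * (N ^ s / s ^ s) := by
      field_simp
    rw [this]
    gcongr
  have hr : (s / b : ℝ) ≤ 3 / 4 := by
    rw [div_le_div_iff₀ hb0 (by norm_num)]
    have : (4 * s : ℝ) ≤ 3 * b := by exact_mod_cast hsb
    linarith
  calc ((2 * b).choose s : ℝ) * b.choose s * ((s / b : ℝ) ^ s) ^ 20
      ≤ (3 * (2 * b : ℕ) / s) ^ s * (3 * b / s) ^ s * ((s / b : ℝ) ^ s) ^ 20 := by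
        gcongr
        · exact hch _
        · exact hch _
    _ = (18 * (s / b : ℝ) ^ 18) ^ s := by
        rw [← pow_mul, mul_comm s 20, pow_mul _ 20 s, ← mul_pow, ← mul_pow]
        congr 1
        push_cast
        field_simp
        ring
    _ ≤ (1 / 4) ^ s := by
        gcongr
        calc 18 * (s / b : ℝ) ^ 18 ≤ 18 * (3 / 4) ^ 18 := by gcongr
          _ ≤ 1 / 4 := by norm_num


/-- A union of twenty permutations of `Y × Fin 2`, projected to `Y`, expands sets. -/
lemma exists_expander (Y : Type*) [Fintype Y] [DecidableEq Y] :
    ∃ R : Y × Fin 2 → Finset Y, (∀ x, (R x).card ≤ 20) ∧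
      (∀ y, (univ.filter fun x => y ∈ R x).card ≤ 40) ∧
      ∀ S : Finset (Y × Fin 2), 4 * S.card ≤ 3 * Fintype.card Y →
        S.card ≤ (S.biUnion R).card := by
  set b := Fintype.card Y with hb
  let R : (Fin 20 → Equiv.Perm (Y × Fin 2)) → Y × Fin 2 → Finset Y :=
    fun σ x => univ.image fun k => (σ k x).1
  suffices h : ∃ σ : Fin 20 → Equiv.Perm (Y × Fin 2), ∀ S : Finset (Y × Fin 2),
      4 * S.card ≤ 3 * b → S.card ≤ (S.biUnion (R σ)).card by
    obtain ⟨σ, hσ⟩ := h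
    refine ⟨R σ, fun x => card_image_le.trans (by simp), fun y => ?_, hσ⟩
    have hsub : (univ.filter fun x => y ∈ R σ x) ⊆
        (univ : Finset (Fin 20 × Fin 2)).image fun kc => (σ kc.1).symm (y, kc.2) := by
      intro x hx
      simp only [R, mem_filter, mem_univ, true_and, mem_image] at hx ⊢
      obtain ⟨k, hk⟩ := hx
      exact ⟨(k, (σ k x).2), by simp [← hk]⟩
    exact (card_le_card hsub).trans (card_image_le.trans (by simp))
  by_contra! hcon
  have hX : Fintype.card (Y × Fin 2) = 2 * b := by simp [hb, mul_comm]
  let Bad : ℕ → Finset (Finset (Y × Fin 2) × Finset Y) := fun s =>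
    powersetCard s univ ×ˢ powersetCard s univ
  let Tup : Finset (Y × Fin 2) × Finset Y → Finset (Fin 20 → Equiv.Perm (Y × Fin 2)) :=
    fun ST => Fintype.piFinset fun _ => permsInto ST.1 (ST.2 ×ˢ univ)
  have hcov : (univ : Finset (Fin 20 → Equiv.Perm (Y × Fin 2))) ⊆
      ((Icc 1 b).filter fun s => 4 * s ≤ 3 * b).biUnion fun s => (Bad s).biUnion Tup := by
    intro σ _
    obtain ⟨S, hS, hlt⟩ := hcon σ
    have hSb : S.card ≤ b := by omega
    obtain ⟨T, hT1, hT2⟩ := exists_superset_card_eq hlt.le (hSb.trans_eq hb)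
    simp only [mem_biUnion, mem_filter, mem_Icc]
    refine ⟨S.card, ⟨⟨by omega, hSb⟩, hS⟩, (S, T), by simp [Bad, hT2], ?_⟩
    simp only [Tup, Fintype.mem_piFinset, permsInto, mem_filter, mem_univ, true_and]
    intro k x hx
    simp only [mem_product, mem_univ, and_true]
    exact hT1 (mem_biUnion.2 ⟨x, hx, mem_image_of_mem _ (mem_univ k)⟩)
  have hF : (0 : ℝ) < (2 * b).factorial := by exact_mod_cast Nat.factorial_pos _
  have hTup : ∀ s, 1 ≤ s → 4 * s ≤ 3 * b → ∀ ST ∈ Bad s,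
      ((Tup ST).card : ℝ) ≤ ((s / b : ℝ) ^ s) ^ 20 * ((2 * b).factorial : ℝ) ^ 20 := by
    intro s hs1 hs ST hST
    simp only [Bad, mem_product, mem_powersetCard, subset_univ, true_and] at hST
    have h := card_permsInto_mul_le ST.1 (ST.2 ×ˢ (univ : Finset (Fin 2)))
    rw [hX, hST.1, card_product, hST.2, card_univ, Fintype.card_fin] at h
    have hb0 : (0 : ℝ) < b := by exact_mod_cast (by omega : 0 < b)
    have h' : ((permsInto ST.1 (ST.2 ×ˢ (univ : Finset (Fin 2)))).card : ℝ) * (2 * b) ^ s ≤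
        (s * 2) ^ s * (2 * b).factorial := by exact_mod_cast h
    have h2 : ((permsInto ST.1 (ST.2 ×ˢ (univ : Finset (Fin 2)))).card : ℝ) ≤
        (s / b : ℝ) ^ s * (2 * b).factorial := by
      rw [← mul_le_mul_iff_left₀ (by positivity : (0 : ℝ) < (2 * b) ^ s)]
      refine h'.trans_eq ?_
      rw [mul_right_comm, ← mul_pow]
      congr 2
      field_simp
    simp only [Tup, Fintype.card_piFinset_const, Nat.cast_pow]
    rw [← mul_pow]
    gcongr
  have htot := card_le_card hcov
  rw [card_univ, Fintype.card_fun, Fintype.card_perm, hX, Fintype.card_fin] at htot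
  have hle : (((2 * b).factorial : ℝ)) ^ 20 ≤
      ∑ s ∈ (Icc 1 b).filter (fun s => 4 * s ≤ 3 * b),
        (1 / 4 : ℝ) ^ s * ((2 * b).factorial : ℝ) ^ 20 := by
    calc (((2 * b).factorial : ℝ)) ^ 20
        ≤ ((((Icc 1 b).filter fun s => 4 * s ≤ 3 * b).biUnion
            fun s => (Bad s).biUnion Tup).card : ℝ) := by exact_mod_cast htot
      _ ≤ ∑ s ∈ (Icc 1 b).filter (fun s => 4 * s ≤ 3 * b),
            (((Bad s).biUnion Tup).card : ℝ) := by exact_mod_cast card_biUnion_le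
      _ ≤ _ := by
        refine sum_le_sum fun s hs => ?_
        simp only [mem_filter, mem_Icc] at hs
        calc (((Bad s).biUnion Tup).card : ℝ)
            ≤ ∑ ST ∈ Bad s, ((Tup ST).card : ℝ) := by exact_mod_cast card_biUnion_le
          _ ≤ (Bad s).card • (((s / b : ℝ) ^ s) ^ 20 * ((2 * b).factorial : ℝ) ^ 20) :=
            sum_le_card_nsmul _ _ _ (hTup s hs.1.1 hs.2)
          _ = ((2 * b).choose s : ℝ) * b.choose s * ((s / b : ℝ) ^ s) ^ 20 *
                ((2 * b).factorial : ℝ) ^ 20 := by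
            simp only [Bad, card_product, card_powersetCard, card_univ, hX, ← hb,
              nsmul_eq_mul, Nat.cast_mul]
            ring
          _ ≤ _ := by
            gcongr
            exact choose_mul_choose_mul_pow_le hs.1.1 hs.2
  have hgeo : ∑ s ∈ (Icc 1 b).filter (fun s => 4 * s ≤ 3 * b), (1 / 4 : ℝ) ^ s < 1 := by
    calc ∑ s ∈ (Icc 1 b).filter (fun s => 4 * s ≤ 3 * b), (1 / 4 : ℝ) ^ s
        ≤ ∑ s ∈ Ico 1 (b + 1), (1 / 4 : ℝ) ^ s := by
          refine sum_le_sum_of_subset_of_nonneg (fun s hs => ?_) fun _ _ _ => by positivity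
          simp only [mem_filter, mem_Icc, mem_Ico] at hs ⊢
          omega
      _ ≤ (1 / 4 : ℝ) ^ 1 / (1 - 1 / 4) :=
          geom_sum_Ico_le_of_lt_one (by norm_num) (by norm_num)
      _ < 1 := by norm_num
  rw [← sum_mul] at hle
  have : 0 < ((2 * b).factorial : ℝ) ^ 20 := by positivity
  nlinarith

/-- Templates of every flexibility with maximum degree at most `60` exist. -/
lemma exists_template (m : ℕ) :
    ∃ T : Finset (Fin (3 * m) × Fin (4 * m)),
      (∀ i, (univ.filter fun j => (i, j) ∈ T).card ≤ 60) ∧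
      (∀ j, (univ.filter fun i => (i, j) ∈ T).card ≤ 60) ∧
      ∀ Jbar : Finset (Fin (4 * m)), (∀ j ∈ Jbar, (j : ℕ) < 2 * m) → Jbar.card = m →
        ∃ f : Fin (3 * m) → Fin (4 * m), Function.Injective f ∧
          ∀ i, (i, f i) ∈ T ∧ f i ∉ Jbar := by
  obtain ⟨R₁, hR₁, hR₁', hexp₁⟩ := exists_expander (Fin (2 * m))
  obtain ⟨R₂, hR₂, hR₂', hexp₂⟩ := exists_expander (Fin (3 * m))
  simp only [Fintype.card_fin] at hexp₁ hexp₂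
  obtain ⟨φ⟩ : Nonempty (Fin (3 * m) ↪ Fin (2 * m) × Fin 2) :=
    Function.Embedding.nonempty_of_card_le (by simp; omega)
  obtain ⟨ψ⟩ : Nonempty (Fin (4 * m) ↪ Fin (3 * m) × Fin 2) :=
    Function.Embedding.nonempty_of_card_le (by simp; omega)
  let c : Fin (2 * m) → Fin (4 * m) := fun k => ⟨2 * m + k, by omega⟩
  have hc : Function.Injective c := fun k k' h => by
    simp only [c, Fin.mk.injEq] at h; ext; omega
  let T : Finset (Fin (3 * m) × Fin (4 * m)) :=
    univ.filter fun e => e.2 ∈ (R₁ (φ e.1)).image c ∨ e.1 ∈ R₂ (ψ e.2)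
  have hT : ∀ i j, (i, j) ∈ T ↔ j ∈ (R₁ (φ i)).image c ∨ i ∈ R₂ (ψ j) := by simp [T]
  refine ⟨T, fun i => ?_, fun j => ?_, fun Jbar hJ hJc => ?_⟩
  · simp only [hT, filter_or]
    refine (card_union_le _ _).trans ?_
    have h1 : (univ.filter fun j => j ∈ (R₁ (φ i)).image c).card ≤ 20 := by
      rw [filter_mem_eq_inter, univ_inter]
      exact card_image_le.trans (hR₁ _)
    have h2 : (univ.filter fun j => i ∈ R₂ (ψ j)).card ≤ 40 := by
      rw [← card_map ψ]
      refine (card_le_card fun x hx => ?_).trans (hR₂' i)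
      simp only [mem_map, mem_filter, mem_univ, true_and] at hx ⊢
      obtain ⟨j, hj, rfl⟩ := hx
      exact hj
    exact Nat.add_le_add h1 h2
  · simp only [hT, filter_or]
    refine (card_union_le _ _).trans ?_
    have h1 : (univ.filter fun i => i ∈ R₂ (ψ j)).card ≤ 20 := by
      rw [filter_mem_eq_inter, univ_inter]
      exact hR₂ _
    have h2 : (univ.filter fun i => j ∈ (R₁ (φ i)).image c).card ≤ 40 := by
      by_cases hj : ∃ k, c k = j
      · obtain ⟨k, rfl⟩ := hj
        rw [← card_map φ]
        refine (card_le_card fun x hx => ?_).trans (hR₁' k)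
        simp only [mem_map, mem_filter, mem_univ, true_and, mem_image] at hx ⊢
        obtain ⟨i, ⟨k', hk', h⟩, rfl⟩ := hx
        rwa [← hc h]
      · rw [filter_false_of_mem]
        · simp
        · intro i _ h
          obtain ⟨k, _, hk⟩ := mem_image.1 h
          exact hj ⟨k, hk⟩
    exact Nat.add_le_add h2 h1
  · let t : Fin (3 * m) → Finset (Fin (4 * m)) :=
      fun i => univ.filter fun j => (i, j) ∈ T ∧ j ∉ Jbar
    suffices h : ∃ f : Fin (3 * m) → Fin (4 * m), Function.Injective f ∧ ∀ i, f i ∈ t i by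
      obtain ⟨f, hf, hf'⟩ := h
      exact ⟨f, hf, fun i => by simpa [t] using hf' i⟩
    rw [← all_card_le_biUnion_card_iff_exists_injective]
    intro S
    by_cases hS : 2 * S.card ≤ 3 * m
    · have h := hexp₁ (S.map φ) (by rw [card_map]; omega)
      rw [card_map] at h
      refine h.trans ?_
      rw [← card_image_of_injective _ hc]
      refine card_le_card fun j hj => ?_
      simp only [mem_image, mem_biUnion, mem_map] at hj
      obtain ⟨k, ⟨x, ⟨i, hi, rfl⟩, hk⟩, rfl⟩ := hj
      simp only [mem_biUnion, t, mem_filter, mem_univ, true_and]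
      refine ⟨i, hi, (hT _ _).2 (Or.inl (mem_image_of_mem _ hk)), fun hmem => ?_⟩
      have := hJ _ hmem
      simp [c] at this
    · by_contra! hlt
      have hm : 1 ≤ m := by
        rcases Nat.eq_zero_or_pos m with rfl | h
        · have := card_le_univ S
          simp at this hS
          simp [this] at hS
        · exact h
      have hS3 : S.card ≤ 3 * m := by simpa using card_le_univ S
      set U := (univ \ Jbar) \ S.biUnion t with hU
      have hUc : 3 * m - S.card + 1 ≤ U.card := by
        have h1 := le_card_sdiff (S.biUnion t) (univ \ Jbar)
        rw [card_sdiff_of_subset (subset_univ _), card_univ, Fintype.card_fin, hJc, ← hU] at h1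
        omega
      obtain ⟨U', hU', hU'c⟩ := exists_subset_card_eq hUc
      have h := hexp₂ (U'.map ψ) (by rw [card_map]; omega)
      have hsub : (U'.map ψ).biUnion R₂ ⊆ univ \ S := by
        intro i hi
        simp only [mem_biUnion, mem_map] at hi
        obtain ⟨x, ⟨j, hj, rfl⟩, hi⟩ := hi
        simp only [mem_sdiff, mem_univ, true_and]
        intro hiS
        have hjU := hU' hj
        simp only [hU, mem_sdiff, mem_univ, true_and, mem_biUnion, not_exists, not_and] at hjU
        exact hjU.2 i hiS (by simp [t, hT, hi, hjU.1])
      have := h.trans (card_le_card hsub)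
      rw [card_sdiff_of_subset (subset_univ _), card_univ, Fintype.card_fin, card_map] at this
      omega

/-- The average of `c ^ |W ∩ N|` over the random subset `W` in which every element lies
independently with probability `1/8`. -/
lemma sum_powerset_weight_mul_pow {V : Type*} [Fintype V] [DecidableEq V] (N : Finset V)
    (c : ℝ) :
    ∑ W : Finset V, (1 / 8 : ℝ) ^ W.card * (7 / 8 : ℝ) ^ (univ \ W).card *
      c ^ (W ∩ N).card = (1 + (c - 1) / 8) ^ N.card := by
  have h := prod_add (fun u => if u ∈ N then c / 8 else 1 / 8) (fun _ => (7 / 8 : ℝ))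
    (univ : Finset V)
  have hl : ∏ u : V, ((if u ∈ N then c / 8 else 1 / 8) + (7 / 8 : ℝ)) =
      (1 + (c - 1) / 8) ^ N.card := by
    rw [← prod_const, ← prod_subset (subset_univ N)]
    · refine prod_congr rfl fun u hu => ?_
      rw [if_pos hu]; ring
    · intro u _ hu
      rw [if_neg hu]; norm_num
  rw [← hl, h, powerset_univ]
  refine sum_congr rfl fun W _ => ?_
  rw [prod_const]
  have : ∏ u ∈ W, (if u ∈ N then c / 8 else 1 / 8) =
      (1 / 8 : ℝ) ^ W.card * c ^ (W ∩ N).card := by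
    calc ∏ u ∈ W, (if u ∈ N then c / 8 else 1 / 8 : ℝ)
        = ∏ u ∈ W, ((1 / 8 : ℝ) * if u ∈ N then c else 1) := by
          refine prod_congr rfl fun u _ => ?_
          split_ifs <;> ring
      _ = _ := by
          rw [prod_mul_distrib, prod_const, prod_ite_mem, prod_const]
  rw [this]
  ring

lemma exists_mul_exp_neg_sqrt_lt (c : ℝ) (hc : 0 < c) :
    ∃ n₀ : ℕ, ∀ n : ℕ, n₀ ≤ n → 1 ≤ n ∧
      (n : ℝ) * Real.exp (-(c * Real.sqrt n)) + Real.exp (-(n / 32 : ℝ)) < 1 := by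
  have h1 : Filter.Tendsto (fun n : ℕ => Real.sqrt (n : ℝ)) Filter.atTop Filter.atTop :=
    Real.tendsto_sqrt_atTop.comp tendsto_natCast_atTop_atTop
  have h2 : Filter.Tendsto (fun n : ℕ => (n : ℝ) * Real.exp (-(c * Real.sqrt n)))
      Filter.atTop (nhds 0) := by
    have h := (tendsto_rpow_mul_exp_neg_mul_atTop_nhds_zero 2 c hc).comp h1
    refine h.congr fun n => ?_
    simp only [Function.comp_apply, neg_mul]
    norm_num
  have h3 : Filter.Tendsto (fun n : ℕ => Real.exp (-(n / 32 : ℝ))) Filter.atTop (nhds 0) := by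
    refine Real.tendsto_exp_neg_atTop_nhds_zero.comp ?_
    exact tendsto_natCast_atTop_atTop.atTop_div_const (by norm_num)
  have h4 := h2.add h3
  rw [add_zero] at h4
  have h5 := (h4.eventually_lt_const (by norm_num : (0 : ℝ) < 1)).and
    (Filter.eventually_ge_atTop 1)
  obtain ⟨n₀, hn₀⟩ := Filter.eventually_atTop.1 h5
  exact ⟨n₀, fun n hn => ⟨(hn₀ n hn).2, (hn₀ n hn).1⟩⟩

/-- A random set of a quarter of the vertices meets all neighbourhoods in at least a
`1/32` proportion of their guaranteed size. -/
lemma exists_subset_card_div_four {V : Type} [Fintype V] [DecidableEq V]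
    (G : SimpleGraph V) [DecidableRel G.Adj] {d : ℝ} {n : ℕ} (hV : Fintype.card V = n)
    (hsmall : (n : ℝ) * Real.exp (-(d / 32)) + Real.exp (-(n / 32 : ℝ)) < 1)
    (hdeg : ∀ v, d ≤ (G.degree v : ℝ)) :
    ∃ W : Finset V, W.card = n / 4 ∧ ∀ v, d / 32 ≤ (degIn G v W : ℝ) := by
  have hinter : ∀ v (W : Finset V), degIn G v W = (W ∩ G.neighborFinset v).card := by
    intro v W
    unfold degIn
    congr 1
    ext u
    simp
  suffices h : ∃ W : Finset V, W.card ≤ n / 4 ∧ ∀ v, d / 32 ≤ (degIn G v W : ℝ) by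
    obtain ⟨W, hW, hd⟩ := h
    obtain ⟨W', hWW', hW'⟩ := exists_superset_card_eq hW (by rw [hV]; omega)
    refine ⟨W', hW', fun v => (hd v).trans ?_⟩
    exact_mod_cast card_le_card (filter_subset_filter _ hWW')
  by_contra! hcon
  let w : Finset V → ℝ := fun W => (1 / 8 : ℝ) ^ W.card * (7 / 8 : ℝ) ^ (univ \ W).card
  have hw : ∀ W, 0 ≤ w W := fun W => by positivity
  have hw1 : ∑ W, w W = 1 := by
    have := sum_powerset_weight_mul_pow (∅ : Finset V) 1
    simpa [w] using this
  let e := Real.exp 1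
  have hlow : ∀ W : Finset V, 1 ≤
      (∑ v, Real.exp (d / 32) * (e⁻¹) ^ (W ∩ G.neighborFinset v).card) +
        Real.exp (-(n / 4 : ℝ)) * e ^ (W ∩ univ).card := by
    intro W
    by_cases hW : W.card ≤ n / 4
    · obtain ⟨v, hv⟩ := hcon W hW
      have h1 : (1 : ℝ) ≤ Real.exp (d / 32) * (e⁻¹) ^ (W ∩ G.neighborFinset v).card := by
        rw [← hinter, ← Real.exp_neg, ← Real.exp_nat_mul, ← Real.exp_add]
        exact Real.one_le_exp (by linarith)
      have h2 := single_le_sum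
        (f := fun v => Real.exp (d / 32) * (e⁻¹) ^ (W ∩ G.neighborFinset v).card)
        (fun i _ => by positivity) (mem_univ v)
      have h3 : 0 ≤ Real.exp (-(n / 4 : ℝ)) * e ^ (W ∩ univ).card := by positivity
      linarith
    · have h1 : (1 : ℝ) ≤ Real.exp (-(n / 4 : ℝ)) * e ^ (W ∩ univ).card := by
        rw [← Real.exp_nat_mul, ← Real.exp_add, inter_univ]
        have : (n : ℝ) ≤ 4 * W.card := by
          have : n ≤ 4 * W.card := by omega
          exact_mod_cast this
        exact Real.one_le_exp (by linarith)
      have h2 : 0 ≤ ∑ v, Real.exp (d / 32) * (e⁻¹) ^ (W ∩ G.neighborFinset v).card :=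
        sum_nonneg fun v _ => by positivity
      linarith
  have hsum : (1 : ℝ) ≤ ∑ W, w W * ((∑ v, Real.exp (d / 32) *
      (e⁻¹) ^ (W ∩ G.neighborFinset v).card) +
        Real.exp (-(n / 4 : ℝ)) * e ^ (W ∩ univ).card) := by
    rw [← hw1]
    exact sum_le_sum fun W _ => le_mul_of_one_le_right (hw W) (hlow W)
  have heq : ∑ W, w W * ((∑ v, Real.exp (d / 32) *
      (e⁻¹) ^ (W ∩ G.neighborFinset v).card) +
        Real.exp (-(n / 4 : ℝ)) * e ^ (W ∩ univ).card) =
      (∑ v, Real.exp (d / 32) * (1 + (e⁻¹ - 1) / 8) ^ (G.neighborFinset v).card) +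
        Real.exp (-(n / 4 : ℝ)) * (1 + (e - 1) / 8) ^ n := by
    simp_rw [mul_add, mul_sum]
    rw [sum_add_distrib, sum_comm]
    congr 1
    · refine sum_congr rfl fun v _ => ?_
      rw [← sum_powerset_weight_mul_pow, mul_sum]
      exact sum_congr rfl fun W _ => by simp only [w]; ring
    · rw [← hV, ← card_univ, ← sum_powerset_weight_mul_pow, mul_sum]
      exact sum_congr rfl fun W _ => by simp only [w]; ring
  have hE1 : (1 : ℝ) + (e⁻¹ - 1) / 8 ≤ Real.exp (-(1 / 16)) := by
    have h1 : e⁻¹ ≤ 1 / 2 := by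
      rw [inv_le_comm₀ (Real.exp_pos 1) (by norm_num)]
      have := Real.exp_one_gt_d9
      linarith
    have := Real.add_one_le_exp (-(1 / 16 : ℝ))
    linarith
  have hE2 : (1 : ℝ) + (e - 1) / 8 ≤ Real.exp (7 / 32) := by
    have h1 := Real.exp_one_lt_d9
    have := Real.add_one_le_exp (7 / 32 : ℝ)
    simp only [e]; linarith
  have hE0 : (0 : ℝ) ≤ 1 + (e⁻¹ - 1) / 8 := by
    have : 0 < e⁻¹ := inv_pos.2 (Real.exp_pos 1)
    linarith
  have hE0' : (0 : ℝ) ≤ 1 + (e - 1) / 8 := by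
    have : 0 < e := Real.exp_pos 1
    linarith
  have hb1 : ∀ v, Real.exp (d / 32) * (1 + (e⁻¹ - 1) / 8) ^ (G.neighborFinset v).card ≤
      Real.exp (-(d / 32)) := by
    intro v
    calc _ ≤ Real.exp (d / 32) * Real.exp (-(1 / 16)) ^ (G.neighborFinset v).card := by gcongr
      _ ≤ Real.exp (-(d / 32)) := by
        rw [← Real.exp_nat_mul, ← Real.exp_add]
        have := hdeg v
        rw [← G.card_neighborFinset_eq_degree] at this
        exact Real.exp_le_exp.2 (by linarith)
  have hb2 : Real.exp (-(n / 4 : ℝ)) * (1 + (e - 1) / 8) ^ n ≤ Real.exp (-(n / 32 : ℝ)) := by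
    calc _ ≤ Real.exp (-(n / 4 : ℝ)) * Real.exp (7 / 32) ^ n := by gcongr
      _ = Real.exp (-(n / 32 : ℝ)) := by
        rw [← Real.exp_nat_mul, ← Real.exp_add]
        congr 1; ring
  have hb3 : ∑ v, Real.exp (d / 32) * (1 + (e⁻¹ - 1) / 8) ^ (G.neighborFinset v).card ≤
      n * Real.exp (-(d / 32)) := by
    refine (sum_le_card_nsmul _ _ _ fun v _ => hb1 v).trans_eq ?_
    rw [card_univ, hV, nsmul_eq_mul]
  linarith

/-- Whenever all vertices of `A` have at most half of the expected number of neighbours in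
`B`, the product `|A||B|` is at most `κ p² n²`. -/
def TypicalDegrees {V : Type} [DecidableEq V] (G : SimpleGraph V) [DecidableRel G.Adj]
    (p κ n : ℝ) : Prop :=
  ∀ A B : Finset V, (∀ a ∈ A, (degIn G a B : ℝ) ≤ p * B.card / 2) →
    (A.card * B.card : ℝ) ≤ κ * p ^ 2 * n ^ 2

lemma ePairs_eq_sum_degIn {V : Type} [DecidableEq V] (G : SimpleGraph V)
    [DecidableRel G.Adj] (A B : Finset V) :
    ePairs G A B = ∑ a ∈ A, degIn G a B := by
  unfold ePairs degIn
  rw [card_filter, sum_product]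
  exact sum_congr rfl fun a _ => (card_filter _ _).symm

lemma Bijumbled.typicalDegrees {V : Type} [Fintype V] [DecidableEq V] {G : SimpleGraph V}
    [DecidableRel G.Adj] {p lam ε n : ℝ} (h : Bijumbled G p lam) (hp : 0 < p) (_hε : 0 ≤ ε)
    (_hn : 0 ≤ n) (hlam : lam ≤ ε * p ^ 2 * n) :
    TypicalDegrees G p (4 * ε ^ 2) n := by
  intro A B hAB
  have hR : 0 ≤ 4 * ε ^ 2 * p ^ 2 * n ^ 2 := by positivity
  rcases A.eq_empty_or_nonempty with rfl | hA
  · simpa using hR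
  rcases B.eq_empty_or_nonempty with rfl | hB
  · simpa using hR
  have h1 := (abs_lt.1 (h A B hA hB)).1
  have h2 : (ePairs G A B : ℝ) ≤ A.card * (p * B.card / 2) := by
    rw [ePairs_eq_sum_degIn, Nat.cast_sum, ← nsmul_eq_mul]
    exact sum_le_card_nsmul _ _ _ hAB
  set q : ℝ := A.card * B.card with hq
  have hq0 : 0 < q := by
    have := hA.card_pos
    have := hB.card_pos
    positivity
  have hs := Real.sq_sqrt hq0.le
  have hs0 := Real.sqrt_pos.2 hq0
  set r := Real.sqrt q
  have h3 : p * q / 2 < lam * r := by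
    have : p * q = p * A.card * B.card := by rw [hq]; ring
    nlinarith
  have h4 : p * q / 2 < ε * p ^ 2 * n * r := h3.trans_le (by gcongr)
  have h5 : r < 2 * ε * p * n := by
    rw [← hs] at h4
    have : 0 < p * r / 2 := by positivity
    refine lt_of_mul_lt_mul_left ?_ this.le
    calc p * r / 2 * r = p * r ^ 2 / 2 := by ring
      _ < ε * p ^ 2 * n * r := h4
      _ = _ := by ring
  rw [← hs]
  calc r ^ 2 ≤ (2 * ε * p * n) ^ 2 := by gcongr
    _ = _ := by ring

/-- A bijumbled graph with small error term cannot be too sparse. -/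
lemma Bijumbled.le_pow_three_mul {V : Type} [Fintype V] [DecidableEq V]
    {G : SimpleGraph V} [DecidableRel G.Adj] {p lam ε δ n : ℝ} (h : Bijumbled G p lam)
    (hp : 0 < p) (hp3 : p ≤ 1 / 3) (hδ : 0 < δ) (hn : 0 < n)
    (hlam : lam ≤ ε * p ^ 2 * n) (v : V) (hv : δ * p * n ≤ (G.degree v : ℝ)) :
    4 * δ ≤ 9 * ε ^ 2 * (p ^ 3 * n) := by
  have hd0 : (0 : ℝ) < G.degree v := lt_of_lt_of_le (by positivity) hv
  have hne : (G.neighborFinset v).Nonempty := by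
    rw [← card_pos, G.card_neighborFinset_eq_degree]
    exact_mod_cast hd0
  have h1 := (abs_lt.1 (h {v} _ (singleton_nonempty v) hne)).2
  have h2 : ePairs G {v} (G.neighborFinset v) = G.degree v := by
    rw [ePairs_eq_sum_degIn, sum_singleton, ← G.card_neighborFinset_eq_degree]
    unfold degIn
    rw [filter_true_of_mem]
    intro u hu
    simpa using hu
  rw [h2, card_singleton, G.card_neighborFinset_eq_degree, Nat.cast_one, one_mul,
    mul_one] at h1
  set d : ℝ := (G.degree v : ℝ)
  have hs := Real.sq_sqrt hd0.le
  have hs0 := Real.sqrt_pos.2 hd0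
  set r := Real.sqrt d
  have h3 : d * (2 / 3) < ε * p ^ 2 * n * r := by
    have : lam * r ≤ ε * p ^ 2 * n * r := by gcongr
    nlinarith
  have h4 : r * (2 / 3) < ε * p ^ 2 * n := by
    rw [← hs] at h3
    refine lt_of_mul_lt_mul_left ?_ hs0.le
    calc r * (r * (2 / 3)) = r ^ 2 * (2 / 3) := by ring
      _ < _ := h3
      _ = _ := by ring
  have h5 : d * (4 / 9) ≤ (ε * p ^ 2 * n) ^ 2 := by
    rw [← hs]
    calc r ^ 2 * (4 / 9) = (r * (2 / 3)) ^ 2 := by ring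
      _ ≤ _ := by gcongr
  have h6 : δ * p * n * (4 / 9) ≤ (ε * p ^ 2 * n) ^ 2 := by linarith
  have hpn : 0 < p * n / 9 := by positivity
  refine le_of_mul_le_mul_left ?_ hpn
  calc p * n / 9 * (4 * δ) = δ * p * n * (4 / 9) := by ring
    _ ≤ _ := h6
    _ = _ := by ring

/-- A partial choice of pairwise disjoint objects that cannot be extended. -/
lemma exists_maximal_disjoint_family {ι β V : Type*} [DecidableEq ι] [DecidableEq V]
    [Nonempty β] (I : Finset ι) (P : ι → β → Prop) (S : ι → β → Finset V) :
    ∃ J ⊆ I, ∃ f : ι → β, (∀ i ∈ J, P i (f i)) ∧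
      (∀ i ∈ J, ∀ j ∈ J, i ≠ j → Disjoint (S i (f i)) (S j (f j))) ∧
      ∀ i ∈ I \ J, ∀ b, P i b → ¬ Disjoint (S i b) (J.biUnion fun j => S j (f j)) := by
  classical
  let good : Finset ι → Prop := fun J => ∃ f : ι → β, (∀ i ∈ J, P i (f i)) ∧
    ∀ i ∈ J, ∀ j ∈ J, i ≠ j → Disjoint (S i (f i)) (S j (f j))
  obtain ⟨J, hJ, hmax⟩ := exists_max_image (I.powerset.filter good) card
    ⟨∅, by simp [good]⟩
  simp only [mem_filter, mem_powerset] at hJ hmax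
  obtain ⟨hJI, f, hf, hd⟩ := hJ
  refine ⟨J, hJI, f, hf, hd, fun i hi b hb hdisj => ?_⟩
  rw [mem_sdiff] at hi
  rw [disjoint_biUnion_right] at hdisj
  have := hmax (insert i J) ⟨insert_subset hi.1 hJI, Function.update f i b, ?_, ?_⟩
  · rw [card_insert_of_notMem hi.2] at this
    omega
  · intro k hk
    by_cases hki : k = i
    · subst hki; simpa using hb
    · rw [Function.update_of_ne hki]
      exact hf k (mem_of_mem_insert_of_ne hk hki)
  · intro k hk l hl hkl
    by_cases hki : k = i
    · subst hki
      rw [Function.update_self, Function.update_of_ne hkl.symm]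
      exact hdisj l (mem_of_mem_insert_of_ne hl hkl.symm)
    · rw [Function.update_of_ne hki]
      by_cases hli : l = i
      · subst hli
        rw [Function.update_self]
        exact (hdisj k (mem_of_mem_insert_of_ne hk hki)).symm
      · rw [Function.update_of_ne hli]
        exact hd k (mem_of_mem_insert_of_ne hk hki) l (mem_of_mem_insert_of_ne hl hli) hkl

/-- Greedy choice of pairwise disjoint objects of bounded size. -/
lemma exists_disjoint_family {ι β V : Type*} [DecidableEq ι] [DecidableEq V]
    [Nonempty β] (I : Finset ι) (P : ι → β → Prop) (S : ι → β → Finset V) (N : ℕ)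
    (hS : ∀ i ∈ I, ∀ b, P i b → (S i b).card ≤ N)
    (hP : ∀ i ∈ I, ∀ X : Finset V, X.card ≤ I.card * N → ∃ b, P i b ∧ Disjoint (S i b) X) :
    ∃ f : ι → β, (∀ i ∈ I, P i (f i)) ∧
      ∀ i ∈ I, ∀ j ∈ I, i ≠ j → Disjoint (S i (f i)) (S j (f j)) := by
  obtain ⟨J, hJI, f, hf, hd, hmax⟩ := exists_maximal_disjoint_family I P S
  have hIJ : I ⊆ J := by
    intro i hi
    by_contra hiJ
    obtain ⟨b, hb, hdisj⟩ := hP i hi (J.biUnion fun j => S j (f j))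
      ((card_biUnion_le_card_mul _ _ N fun j hj => hS j (hJI hj) _ (hf j hj)).trans
        (Nat.mul_le_mul_right _ (card_le_card hJI)))
    exact hmax i (mem_sdiff.2 ⟨hi, hiJ⟩) b hb hdisj
  exact ⟨f, fun i hi => hf i (hIJ hi), fun i hi j hj => hd i (hIJ hi) j (hIJ hj)⟩

/-- A walk together with its ends. -/
structure BundledWalk {V : Type} (G : SimpleGraph V) where
  /-- The first vertex. -/
  fst : V
  /-- The last vertex. -/
  snd : V
  /-- The underlying walk. -/
  walk : G.Walk fst snd

/-- The vertex set of a walk. -/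
def BundledWalk.verts {V : Type} [DecidableEq V] {G : SimpleGraph V} (w : BundledWalk G) :
    Finset V :=
  w.walk.support.toFinset

lemma BundledWalk.card_verts_le {V : Type} [DecidableEq V] {G : SimpleGraph V}
    (w : BundledWalk G) : w.verts.card ≤ w.walk.length + 1 :=
  (List.toFinset_card_le _).trans_eq w.walk.length_support

/-- Prepending a vertex to a path. -/
lemma BundledWalk.exists_cons {V : Type} [DecidableEq V] {G : SimpleGraph V}
    (w : BundledWalk G) {x : V} (hxw : G.Adj x w.fst) (hx : x ∉ w.verts)
    (hw : w.walk.IsPath) :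
    ∃ w' : BundledWalk G, w'.fst = x ∧ w'.snd = w.snd ∧ w'.walk.IsPath ∧
      w'.walk.length = w.walk.length + 1 ∧ w'.verts = insert x w.verts :=
  ⟨⟨x, w.snd, .cons hxw w.walk⟩, rfl, rfl,
    (SimpleGraph.Walk.cons_isPath_iff _ _).2 ⟨hw, fun h => hx (List.mem_toFinset.2 h)⟩,
    SimpleGraph.Walk.length_cons _ _, by simp [BundledWalk.verts]⟩

/-- Any `r` vertices and any `t` vertices are joined by an edge. -/
def EdgeBetween {V : Type} (G : SimpleGraph V) (r t : ℕ) : Prop :=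
  ∀ A B : Finset V, r ≤ A.card → t ≤ B.card → ∃ a ∈ A, ∃ b ∈ B, G.Adj a b

lemma EdgeBetween.exists_neighbors {V : Type} [DecidableEq V] {G : SimpleGraph V}
    {r t : ℕ} (h : EdgeBetween G r t) (R F : Finset V) (hR : r ≤ R.card)
    (hF : 2 * t ≤ F.card) :
    ∃ R' ⊆ F, t ≤ R'.card ∧ ∀ y ∈ R', ∃ x ∈ R, G.Adj x y := by
  classical
  refine ⟨F.filter fun y => ∃ x ∈ R, G.Adj x y, filter_subset _ _, ?_, fun y hy =>
    (mem_filter.1 hy).2⟩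
  by_contra! hlt
  have hc := card_filter_add_card_filter_not (s := F) (fun y => ∃ x ∈ R, G.Adj x y)
  obtain ⟨x, hx, y, hy, hxy⟩ := h R (F.filter fun y => ¬ ∃ x ∈ R, G.Adj x y) hR (by omega)
  exact (mem_filter.1 hy).2 ⟨x, hx, hxy⟩

/-- Connecting a large set to a moderately large set by a path of length `s + 1`. -/
lemma EdgeBetween.exists_path_succ {V : Type} [DecidableEq V] {G : SimpleGraph V}
    {r t : ℕ} (h : EdgeBetween G r t) (hrt : r ≤ t) (s : ℕ) (R F Y : Finset V)
    (hR : t ≤ R.card) (hY : r ≤ Y.card) (hF : s * (2 * t) ≤ F.card)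
    (hRF : Disjoint R F) (hRY : Disjoint R Y) (hFY : Disjoint F Y) :
    ∃ w : BundledWalk G, w.fst ∈ R ∧ w.snd ∈ Y ∧ w.walk.IsPath ∧ w.walk.length = s + 1 ∧
      w.verts ⊆ R ∪ F ∪ Y := by
  induction s generalizing R F with
  | zero =>
    obtain ⟨y, hy, x, hx, hyx⟩ := h Y R hY hR
    refine ⟨⟨x, y, .cons hyx.symm .nil⟩, hx, hy, ?_, rfl, ?_⟩
    · simp [hyx.ne']
    · intro z hz
      simp only [BundledWalk.verts, SimpleGraph.Walk.support_cons,
        SimpleGraph.Walk.support_nil, List.mem_toFinset, List.mem_cons,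
        List.not_mem_nil, or_false] at hz
      rcases hz with rfl | rfl <;> simp [hx, hy]
  | succ s ih =>
    obtain ⟨F₁, hF₁, hF₁c⟩ := exists_subset_card_eq (s := F) (n := 2 * t) (by nlinarith)
    obtain ⟨R', hR', hR'c, hadj⟩ := h.exists_neighbors R F₁ (hrt.trans hR) hF₁c.ge
    have hR'F := hR'.trans hF₁
    obtain ⟨w, hw1, hw2, hw3, hw4, hw5⟩ := ih R' (F \ F₁) hR'c
      (by rw [card_sdiff_of_subset hF₁, hF₁c]; exact Nat.le_sub_of_add_le (by linarith))
      (disjoint_sdiff.mono_left hR') (hFY.mono_left hR'F) (hFY.mono_left sdiff_subset)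
    obtain ⟨x, hx, hxw⟩ := hadj _ hw1
    have hsub : w.verts ⊆ F ∪ Y :=
      hw5.trans (union_subset (union_subset (hR'F.trans subset_union_left)
        (sdiff_subset.trans subset_union_left)) subset_union_right)
    have hxF : x ∉ w.verts := fun hmem => by
      rcases mem_union.1 (hsub hmem) with h' | h'
      · exact disjoint_left.1 hRF hx h'
      · exact disjoint_left.1 hRY hx h'
    obtain ⟨w', h1, h2, h3, h4, h5⟩ := w.exists_cons hxw hxF hw3
    refine ⟨w', h1 ▸ hx, h2 ▸ hw2, h3, by rw [h4, hw4], ?_⟩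
    rw [h5, union_assoc]
    exact insert_subset (mem_union_left _ hx) (hsub.trans subset_union_right)

/-- Connecting two moderately large sets by a path of length `s + 2`. -/
lemma EdgeBetween.exists_path_add_two {V : Type} [DecidableEq V] {G : SimpleGraph V}
    {r t : ℕ} (h : EdgeBetween G r t) (hrt : r ≤ t) (s : ℕ) (R F Y : Finset V)
    (hR : r ≤ R.card) (hY : r ≤ Y.card) (hF : (s + 1) * (2 * t) ≤ F.card)
    (hRF : Disjoint R F) (hRY : Disjoint R Y) (hFY : Disjoint F Y) :
    ∃ w : BundledWalk G, w.fst ∈ R ∧ w.snd ∈ Y ∧ w.walk.IsPath ∧ w.walk.length = s + 2 ∧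
      w.verts ⊆ R ∪ F ∪ Y := by
  obtain ⟨F₁, hF₁, hF₁c⟩ := exists_subset_card_eq (s := F) (n := 2 * t) (by nlinarith)
  obtain ⟨R', hR', hR'c, hadj⟩ := h.exists_neighbors R F₁ hR hF₁c.ge
  have hR'F := hR'.trans hF₁
  obtain ⟨w, hw1, hw2, hw3, hw4, hw5⟩ := h.exists_path_succ hrt s R' (F \ F₁) Y hR'c hY
    (by rw [card_sdiff_of_subset hF₁, hF₁c]; exact Nat.le_sub_of_add_le (by linarith))
    (disjoint_sdiff.mono_left hR') (hFY.mono_left hR'F) (hFY.mono_left sdiff_subset)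
  obtain ⟨x, hx, hxw⟩ := hadj _ hw1
  have hsub : w.verts ⊆ F ∪ Y :=
    hw5.trans (union_subset (union_subset (hR'F.trans subset_union_left)
      (sdiff_subset.trans subset_union_left)) subset_union_right)
  have hxF : x ∉ w.verts := fun hmem => by
    rcases mem_union.1 (hsub hmem) with h' | h'
    · exact disjoint_left.1 hRF hx h'
    · exact disjoint_left.1 hRY hx h'
  obtain ⟨w', h1, h2, h3, h4, h5⟩ := w.exists_cons hxw hxF hw3
  refine ⟨w', h1 ▸ hx, h2 ▸ hw2, h3, by rw [h4, hw4], ?_⟩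
  rw [h5, union_assoc]
  exact insert_subset (mem_union_left _ hx) (hsub.trans subset_union_right)

lemma BundledWalk.exists_reverse {V : Type} [DecidableEq V] {G : SimpleGraph V}
    (w : BundledWalk G) (hw : w.walk.IsPath) :
    ∃ w' : BundledWalk G, w'.fst = w.snd ∧ w'.snd = w.fst ∧ w'.walk.IsPath ∧
      w'.walk.length = w.walk.length ∧ w'.verts = w.verts :=
  ⟨⟨w.snd, w.fst, w.walk.reverse⟩, rfl, rfl, hw.reverse, w.walk.length_reverse, by
    simp [BundledWalk.verts]⟩

/-- The quantitative pseudorandomness assumptions under which the blocks of an absorbing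
structure with paths on `L` vertices can be found in every large vertex set. -/
structure Pseudorandom {V : Type} [DecidableEq V] (G : SimpleGraph V) [DecidableRel G.Adj]
    (p κ : ℝ) (n L : ℕ) : Prop where
  p_pos : 0 < p
  p_le : p ≤ 1 / 3
  κ_nonneg : 0 ≤ κ
  L_pos : 1 ≤ L
  κ_le : κ * (10 ^ 7 * (L : ℝ) ^ 2) ≤ 1
  large : 10 ^ 6 * (L : ℝ) ≤ p ^ 2 * n
  typical : TypicalDegrees G p κ n

namespace Pseudorandom

variable {V : Type} [DecidableEq V] {G : SimpleGraph V} [DecidableRel G.Adj]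
  {p κ : ℝ} {n L : ℕ}

lemma one_le_L (h : Pseudorandom G p κ n L) : (1 : ℝ) ≤ L := by exact_mod_cast h.L_pos

lemma sq_mul_le (h : Pseudorandom G p κ n L) : p ^ 2 * n ≤ p * n / 3 := by
  have hn : (0 : ℝ) ≤ n := n.cast_nonneg
  have := mul_le_mul_of_nonneg_right h.p_le (mul_nonneg h.p_pos.le hn)
  nlinarith

lemma mul_le (h : Pseudorandom G p κ n L) : p * n ≤ n / 3 := by
  have hn : (0 : ℝ) ≤ n := n.cast_nonneg
  nlinarith [h.p_le]

lemma κ_le' (h : Pseudorandom G p κ n L) : κ * (10 ^ 7 * (L : ℝ)) ≤ 1 := by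
  have h1 := h.one_le_L
  have h2 := h.κ_nonneg
  refine le_trans ?_ h.κ_le
  gcongr
  nlinarith

lemma κ_le_const (h : Pseudorandom G p κ n L) : κ ≤ 1 / 10 ^ 7 := by
  have h1 := h.one_le_L
  have h2 := h.κ_nonneg
  have := h.κ_le'
  nlinarith

/-- Few vertices have low degree into a set of at least `c p n` vertices. -/
lemma card_low_le (h : Pseudorandom G p κ n L) (A B : Finset V) {c : ℝ} (_hc : 0 < c)
    (hB : c * (p * n) ≤ B.card) (hAB : ∀ a ∈ A, (degIn G a B : ℝ) ≤ p * B.card / 2) :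
    (A.card : ℝ) * c ≤ κ * (p * n) := by
  have h1 := h.typical A B hAB
  have hlarge := h.large
  have hL := h.one_le_L
  have hp := h.p_pos
  have hsq := h.sq_mul_le
  have hpn : 0 < p * n := by nlinarith
  have h2 : (A.card : ℝ) * (c * (p * n)) ≤ A.card * B.card := by gcongr
  refine le_of_mul_le_mul_right ?_ hpn
  calc _ = (A.card : ℝ) * (c * (p * n)) := by ring
    _ ≤ κ * p ^ 2 * n ^ 2 := h2.trans h1
    _ = _ := by ring

lemma exists_edgeBetween (h : Pseudorandom G p κ n L) :
    ∃ r t : ℕ, EdgeBetween G r t ∧ r ≤ t ∧ (r : ℝ) ≤ p ^ 2 * n / 1024 + 1 ∧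
      (L : ℝ) * t ≤ n / 128 + L := by
  have hL := h.one_le_L
  have hL0 : (0 : ℝ) < L := by linarith
  have hp := h.p_pos
  have hlarge := h.large
  have hn : (0 : ℝ) < n := by
    by_contra! hn
    have : p ^ 2 * n ≤ 0 := mul_nonpos_of_nonneg_of_nonpos (by positivity) hn
    nlinarith
  have hppn : p ^ 2 * n / (1024 * L) ≤ n / (128 * L) := by
    rw [div_le_div_iff₀ (by positivity) (by positivity)]
    have := h.sq_mul_le
    have := h.mul_le
    nlinarith
  refine ⟨⌈p ^ 2 * n / (1024 * L)⌉₊, ⌈n / (128 * L : ℝ)⌉₊, ?_, Nat.ceil_le_ceil hppn, ?_, ?_⟩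
  · intro A B hA hB
    by_contra! hno
    have h1 := h.typical A B fun a ha => by
      have : degIn G a B = 0 := by
        unfold degIn
        rw [card_eq_zero, filter_eq_empty_iff]
        exact fun b hb => hno a ha b hb
      rw [this]
      push_cast
      positivity
    have hA' := Nat.ceil_le.1 hA
    have hB' := Nat.ceil_le.1 hB
    have h2 : p ^ 2 * n / (1024 * L) * (n / (128 * L)) ≤ κ * p ^ 2 * n ^ 2 := by
      refine le_trans ?_ h1
      gcongr
    have h3 : p ^ 2 * n / (1024 * L) * (n / (128 * L : ℝ)) =
        p ^ 2 * n ^ 2 / (131072 * L ^ 2) := by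
      field_simp
      norm_num
    rw [h3, div_le_iff₀ (by positivity)] at h2
    have h4 := h.κ_le
    have h5 : 0 < p ^ 2 * n ^ 2 := by positivity
    nlinarith
  · refine (Nat.ceil_lt_add_one (by positivity)).le.trans ?_
    gcongr
    linarith
  · have := (Nat.ceil_lt_add_one (by positivity : (0 : ℝ) ≤ n / (128 * L : ℝ))).le
    calc (L : ℝ) * ⌈n / (128 * L : ℝ)⌉₊ ≤ L * (n / (128 * L : ℝ) + 1) := by gcongr
      _ = _ := by field_simp

end Pseudorandom

/-- A path `b.1` of length `s` inside `F`, together with distinct common neighbours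
`b.2 j`, `j ∈ J`, of its ends inside `F` and off the path. -/
structure IsRootBlock {V β : Type} [DecidableEq V] (G : SimpleGraph V) (s : ℕ)
    (F : Finset V) (J : Finset β) (b : BundledWalk G × (β → V)) : Prop where
  isPath : b.1.walk.IsPath
  length_eq : b.1.walk.length = s
  verts_subset : b.1.verts ⊆ F
  mem : ∀ j ∈ J, b.2 j ∈ F
  injOn : Set.InjOn b.2 J
  notMem_verts : ∀ j ∈ J, b.2 j ∉ b.1.verts
  adj : ∀ j ∈ J, G.Adj (b.2 j) b.1.fst ∧ G.Adj (b.2 j) b.1.snd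

/-- A vertex `b.1` and disjoint paths `b.2 i`, `i ∈ I`, of length `s` inside `F` avoiding
`b.1`, such that the ends of `b.2 i` are adjacent to `a i` and `b.1`. -/
structure IsLinkBlock {V β : Type} [DecidableEq V] (G : SimpleGraph V) (s : ℕ)
    (F : Finset V) (I : Finset β) (a : β → V) (b : V × (β → BundledWalk G)) : Prop where
  mem : b.1 ∈ F
  isPath : ∀ i ∈ I, (b.2 i).walk.IsPath
  length_eq : ∀ i ∈ I, (b.2 i).walk.length = s
  verts_subset : ∀ i ∈ I, (b.2 i).verts ⊆ F
  notMem_verts : ∀ i ∈ I, b.1 ∉ (b.2 i).verts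
  adj_left : ∀ i ∈ I, G.Adj (a i) (b.2 i).fst ∧ G.Adj (a i) (b.2 i).snd
  adj_right : ∀ i ∈ I, G.Adj b.1 (b.2 i).fst ∧ G.Adj b.1 (b.2 i).snd
  disjoint : ∀ i ∈ I, ∀ i' ∈ I, i ≠ i' → Disjoint (b.2 i).verts (b.2 i').verts

lemma Pseudorandom.exists_linkBlock {V β : Type} [DecidableEq V] [DecidableEq β]
    {G : SimpleGraph V} [DecidableRel G.Adj] {p κ : ℝ} {n s : ℕ}
    (h : Pseudorandom G p κ n (s + 1)) (hs : 2 ≤ s) (F : Finset V) (I : Finset β) (a : β → V)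
    (hI : I.card ≤ 60) (hF : (n / 16 : ℝ) ≤ F.card)
    (ha : ∀ i ∈ I, p * n / 64 ≤ (degIn G (a i) F : ℝ)) :
    ∃ b, IsLinkBlock G s F I a b := by
  obtain ⟨k, rfl⟩ := Nat.exists_eq_add_of_le' hs
  obtain ⟨r, t, hE, hrt, hr, ht⟩ := h.exists_edgeBetween
  have hL := h.one_le_L
  have hlarge := h.large
  have hsq := h.sq_mul_le
  have hpn3 := h.mul_le
  have hp := h.p_pos
  have hκc := h.κ_le_const
  have hκ0 := h.κ_nonneg
  set L : ℕ := k + 2 + 1 with hLdef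
  have hn0 : (0 : ℝ) ≤ n := n.cast_nonneg
  let D : β → Finset V := fun i => F.filter fun u => G.Adj (a i) u
  have hD : ∀ i ∈ I, 1 / 64 * (p * n) ≤ (D i).card := fun i hi => by
    have := ha i hi
    unfold degIn at this
    simp only [D]
    linarith
  let B : β → Finset V := fun i => F.filter fun z => (degIn G z (D i) : ℝ) ≤ p * (D i).card / 2
  have hB : ∀ i ∈ I, ((B i).card : ℝ) ≤ n / 10 ^ 5 := fun i hi => by
    have := h.card_low_le (B i) (D i) (by norm_num) (hD i hi) fun z hz => (mem_filter.1 hz).2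
    nlinarith
  obtain ⟨z, hzF, hzB⟩ : ∃ z ∈ F, z ∉ I.biUnion B := by
    refine exists_mem_notMem_of_card_lt_card ?_
    have h1 : ((I.biUnion B).card : ℝ) ≤ 60 * (n / 10 ^ 5) := by
      calc ((I.biUnion B).card : ℝ) ≤ ∑ i ∈ I, ((B i).card : ℝ) := by
            exact_mod_cast card_biUnion_le
        _ ≤ I.card • ((n : ℝ) / 10 ^ 5) := sum_le_card_nsmul _ _ _ hB
        _ ≤ 60 * (n / 10 ^ 5) := by
          rw [nsmul_eq_mul]
          gcongr
          exact_mod_cast hI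
    have h2 : ((I.biUnion B).card : ℝ) < F.card := by linarith
    exact_mod_cast h2
  have hz : ∀ i ∈ I, p ^ 2 * n / 128 ≤ (((D i).filter fun u => G.Adj z u).card : ℝ) := by
    intro i hi
    have h1 : z ∉ B i := fun hmem => hzB (mem_biUnion.2 ⟨i, hi, hmem⟩)
    simp only [B, mem_filter, not_and, not_le] at h1
    have h2 := h1 hzF
    unfold degIn at h2
    have h3 := hD i hi
    nlinarith
  have : Nonempty (BundledWalk G) := ⟨⟨z, z, .nil⟩⟩
  let P : β → BundledWalk G → Prop := fun i w =>
    w.walk.IsPath ∧ w.walk.length = k + 2 ∧ w.verts ⊆ F ∧ z ∉ w.verts ∧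
      (G.Adj (a i) w.fst ∧ G.Adj (a i) w.snd) ∧ G.Adj z w.fst ∧ G.Adj z w.snd
  have hS : ∀ i ∈ I, ∀ w, P i w → w.verts.card ≤ L := fun i _ w hw => by
    have := w.card_verts_le
    rw [hw.2.1] at this
    exact this
  suffices hP : ∀ i ∈ I, ∀ X : Finset V, X.card ≤ I.card * L →
      ∃ w, P i w ∧ Disjoint w.verts X by
    obtain ⟨f, hf, hfd⟩ := exists_disjoint_family I P (fun _ w => w.verts) L hS hP
    exact ⟨(z, f), hzF, fun i hi => (hf i hi).1, fun i hi => (hf i hi).2.1,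
      fun i hi => (hf i hi).2.2.1, fun i hi => (hf i hi).2.2.2.1,
      fun i hi => (hf i hi).2.2.2.2.1, fun i hi => (hf i hi).2.2.2.2.2, hfd⟩
  intro i hi X hX
  have hX' : (X.card : ℝ) ≤ 60 * L := by
    have : X.card ≤ 60 * L := hX.trans (Nat.mul_le_mul_right _ hI)
    exact_mod_cast this
  set C := (D i).filter (fun u => G.Adj z u) \ X with hC
  have hCadj : ∀ u ∈ C, u ∈ F ∧ G.Adj (a i) u ∧ G.Adj z u ∧ u ∉ X := by
    intro u hu
    simp only [hC, D, mem_sdiff, mem_filter] at hu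
    tauto
  have hCc : r + r ≤ C.card := by
    have h1 := le_card_sdiff X ((D i).filter fun u => G.Adj z u)
    rw [← hC] at h1
    have h2 : (((D i).filter fun u => G.Adj z u).card : ℝ) - X.card ≤ C.card := by
      rw [sub_le_iff_le_add]
      exact_mod_cast (by omega :
        ((D i).filter fun u => G.Adj z u).card ≤ C.card + X.card)
    have h3 := hz i hi
    have : ((r + r : ℕ) : ℝ) ≤ C.card := by
      push_cast
      linarith
    exact_mod_cast this
  obtain ⟨R, hRC, hR⟩ := exists_subset_card_eq (by omega : r ≤ C.card)
  obtain ⟨Y, hYC, hY⟩ := exists_subset_card_eq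
    (by rw [card_sdiff_of_subset hRC]; omega : r ≤ (C \ R).card)
  set F' := F \ insert z (X ∪ R ∪ Y) with hF'
  have hF'c : (k + 1) * (2 * t) ≤ F'.card := by
    have h1 := le_card_sdiff (insert z (X ∪ R ∪ Y)) F
    have h2 : (insert z (X ∪ R ∪ Y)).card ≤ X.card + r + r + 1 := by
      refine (card_insert_le _ _).trans ?_
      have := card_union_le (X ∪ R) Y
      have := card_union_le X R
      omega
    rw [← hF'] at h1
    have h3 : F.card ≤ F'.card + (X.card + r + r + 1) := by omega
    have h4 : (F.card : ℝ) ≤ F'.card + (X.card + r + r + 1) := by exact_mod_cast h3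
    have h5 : (k + 1) * (2 * t) ≤ 2 * (L * t) :=
      (Nat.le_add_right _ (4 * t)).trans_eq (by rw [hLdef]; ring)
    have h6 : ((2 * (L * t) : ℕ) : ℝ) ≤ F'.card := by
      push_cast
      linarith
    exact h5.trans (by exact_mod_cast h6)
  have hYC' : Y ⊆ C := hYC.trans sdiff_subset
  obtain ⟨w, hw1, hw2, hw3, hw4, hw5⟩ := hE.exists_path_add_two hrt k R F' Y hR.ge hY.ge hF'c
    (disjoint_left.2 fun u hu hu' => by simp [hF', hu] at hu')
    (disjoint_left.2 fun u hu hu' => (mem_sdiff.1 (hYC hu')).2 hu)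
    (disjoint_left.2 fun u hu' hu => by simp [hF', hu] at hu')
  have hmem : ∀ u ∈ w.verts, u ∈ C ∨ u ∈ F' := by
    intro u hu
    have := hw5 hu
    simp only [mem_union] at this
    rcases this with (h' | h') | h'
    · exact Or.inl (hRC h')
    · exact Or.inr h'
    · exact Or.inl (hYC' h')
  have h1 := hCadj _ (hRC hw1)
  have h2 := hCadj _ (hYC' hw2)
  refine ⟨w, ⟨hw3, hw4, fun u hu => ?_, fun hu => ?_, ⟨h1.2.1, h2.2.1⟩, h1.2.2.1, h2.2.2.1⟩,
    disjoint_left.2 fun u hu huX => ?_⟩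
  · rcases hmem u hu with h' | h'
    · exact (hCadj u h').1
    · exact (mem_sdiff.1 h').1
  · rcases hmem z hu with h' | h'
    · exact G.loopless.irrefl z (hCadj z h').2.2.1
    · simp [hF'] at h'
  · rcases hmem u hu with h' | h'
    · exact (hCadj u h').2.2.2 huX
    · simp [hF', huX] at h'

lemma exists_injOn_mapsTo_of_card_le {β V : Type} [Nonempty V] (J : Finset β) (C : Finset V)
    (h : J.card ≤ C.card) : ∃ f : β → V, Set.InjOn f J ∧ ∀ j ∈ J, f j ∈ C := by
  classical
  obtain ⟨e⟩ : Nonempty (J ↪ C) := Function.Embedding.nonempty_of_card_le (by simpa using h)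
  refine ⟨fun j => if hj : j ∈ J then e ⟨j, hj⟩ else Classical.arbitrary V, ?_, ?_⟩
  · intro x hx y hy hxy
    rw [mem_coe] at hx hy
    simp only [hx, hy, dif_pos] at hxy
    simpa using e.injective (Subtype.ext hxy)
  · intro j hj
    simp only [hj, dif_pos]
    exact (e ⟨j, hj⟩).2

set_option maxHeartbeats 1000000 in
lemma Pseudorandom.exists_rootBlock {V β : Type} [DecidableEq V]
    {G : SimpleGraph V} [DecidableRel G.Adj] {p κ : ℝ} {n s : ℕ}
    (h : Pseudorandom G p κ n (s + 1)) (hs : 2 ≤ s) (F : Finset V) (J : Finset β)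
    (hJ : J.card ≤ 60) (hF : (n / 16 : ℝ) ≤ F.card) :
    ∃ b, IsRootBlock G s F J b := by
  obtain ⟨k, rfl⟩ := Nat.exists_eq_add_of_le' hs
  obtain ⟨r, t, hE, hrt, hr, ht⟩ := h.exists_edgeBetween
  have hL := h.one_le_L
  have hlarge := h.large
  have hsq := h.sq_mul_le
  have hpn3 := h.mul_le
  have hp := h.p_pos
  have hκc := h.κ_le_const
  have hκ0 := h.κ_nonneg
  set L : ℕ := k + 2 + 1 with hLdef
  have hn0 : (0 : ℝ) ≤ n := n.cast_nonneg
  have hL3 : (3 : ℝ) ≤ L := by rw [hLdef]; push_cast; linarith [(k.cast_nonneg : (0 : ℝ) ≤ k)]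
  obtain ⟨x, hxF, hx⟩ : ∃ x ∈ F, p * F.card / 2 < (degIn G x F : ℝ) := by
    by_contra! hno
    have := h.card_low_le F F (c := 1 / 16) (by norm_num) (by nlinarith) hno
    nlinarith
  set N := F.filter fun u => G.Adj x u with hN
  have hNc : p * n / 32 ≤ (N.card : ℝ) := by
    unfold degIn at hx
    rw [← hN] at hx
    nlinarith
  obtain ⟨q, hq1, hq2⟩ : ∃ q : ℕ, p * n / 128 ≤ (q : ℝ) ∧ (q : ℝ) ≤ p * n / 128 + 1 :=
    ⟨⌈p * n / 128⌉₊, Nat.le_ceil _, (Nat.ceil_lt_add_one (by positivity)).le⟩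
  have hqN : q + q ≤ N.card := by
    have : ((q + q : ℕ) : ℝ) ≤ N.card := by push_cast; linarith
    exact_mod_cast this
  obtain ⟨D, hDN, hD⟩ := exists_subset_card_eq (by omega : q ≤ N.card)
  obtain ⟨R, hRN, hR⟩ := exists_subset_card_eq
    (by rw [card_sdiff_of_subset hDN]; omega : q ≤ (N \ D).card)
  have hRN' : R ⊆ N := hRN.trans sdiff_subset
  set F' := F \ insert x (D ∪ R) with hF'
  have hF'c : (n / 32 : ℝ) ≤ F'.card := by
    have h1 := le_card_sdiff (insert x (D ∪ R)) F
    have h2 := card_insert_le x (D ∪ R)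
    have h3 := card_union_le D R
    rw [← hF'] at h1
    have h4 : (F.card : ℝ) ≤ F'.card + (q + q + 1) := by
      exact_mod_cast (by omega : F.card ≤ F'.card + (q + q + 1))
    linarith
  set B := F'.filter fun y => (degIn G y D : ℝ) ≤ p * D.card / 2 with hB
  have hBc : (B.card : ℝ) ≤ n / 1000 := by
    have := h.card_low_le B D (c := 1 / 128) (by norm_num) (by rw [hD]; linarith)
      fun y hy => (mem_filter.1 hy).2
    nlinarith
  have htn : (t : ℝ) ≤ n / 128 := by nlinarith
  have hYc : t ≤ (F' \ B).card := by
    have h1 := le_card_sdiff B F'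
    have h2 : (F'.card : ℝ) ≤ (F' \ B).card + B.card := by
      exact_mod_cast (by omega : F'.card ≤ (F' \ B).card + B.card)
    have : (t : ℝ) ≤ (F' \ B).card := by linarith
    exact_mod_cast this
  obtain ⟨Y, hYB, hY⟩ := exists_subset_card_eq hYc
  have hYF' : Y ⊆ F' := hYB.trans sdiff_subset
  have hFYc : k * (2 * t) ≤ (F' \ Y).card := by
    have h1 : F'.card = (F' \ Y).card + t := by
      rw [← hY, card_sdiff_add_card_eq_card hYF']
    have h2 : (F'.card : ℝ) = (F' \ Y).card + t := by exact_mod_cast h1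
    have h5 : k * (2 * t) + t ≤ 2 * (L * t) :=
      (Nat.le_add_right _ (5 * t)).trans_eq (by rw [hLdef]; ring)
    have h5' : (k * (2 * t) + t : ℝ) ≤ 2 * (L * t) := by exact_mod_cast h5
    have h6 : (k * (2 * t) : ℝ) ≤ (F' \ Y).card := by linarith
    exact_mod_cast h6
  have hrq : r ≤ R.card := by
    rw [hR]
    have : (r : ℝ) ≤ q := by linarith
    exact_mod_cast this
  have hxadj : ∀ u ∈ N, u ∈ F ∧ G.Adj x u := fun u hu => mem_filter.1 hu
  have hF'R : Disjoint F' R := disjoint_left.2 fun u hu hu' => by simp [hF', hu'] at hu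
  obtain ⟨w, hw1, hw2, hw3, hw4, hw5⟩ := hE.exists_path_succ hrt k Y (F' \ Y) R hY.ge hrq hFYc
    disjoint_sdiff (hF'R.mono_left hYF') (hF'R.mono_left sdiff_subset)
  have hwsub : w.verts ⊆ F' ∪ R :=
    hw5.trans (union_subset (union_subset (hYF'.trans subset_union_left)
      (sdiff_subset.trans subset_union_left)) subset_union_right)
  obtain ⟨w', hw'1, hw'2, hw'3, hw'4, hw'5⟩ := w.exists_reverse hw3
  have hxR : x ∉ R := fun hmem => G.loopless.irrefl x (hxadj x (hRN' hmem)).2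
  obtain ⟨P, hP1, hP2, hP3, hP4, hP5⟩ := w'.exists_cons (x := x)
    (by rw [hw'1]; exact (hxadj _ (hRN' hw2)).2)
    (by
      rw [hw'5]
      intro hmem
      rcases mem_union.1 (hwsub hmem) with h' | h'
      · simp [hF'] at h'
      · exact hxR h') hw'3
  have hyD : p ^ 2 * n / 256 ≤ ((D.filter fun u => G.Adj w.fst u).card : ℝ) := by
    have h1 := (mem_sdiff.1 (hYB hw1)).2
    simp only [hB, mem_filter, not_and, not_le] at h1
    have h2 := h1 (hYF' hw1)
    unfold degIn at h2
    rw [hD] at h2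
    nlinarith
  have : Nonempty V := ⟨x⟩
  obtain ⟨f, hf, hfC⟩ := exists_injOn_mapsTo_of_card_le J (D.filter fun u => G.Adj w.fst u)
    (by
      have h1 : (J.card : ℝ) ≤ 60 := by exact_mod_cast hJ
      have h2 : (J.card : ℝ) ≤ (D.filter fun u => G.Adj w.fst u).card := by linarith
      exact_mod_cast h2)
  simp only [mem_filter] at hfC
  have hRD : Disjoint R D := disjoint_left.2 fun u hu => (mem_sdiff.1 (hRN hu)).2
  refine ⟨(P, f), hP3, by simp only [hP4, hw'4, hw4], ?_, fun j hj => (hxadj _ (hDN (hfC j hj).1)).1,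
    hf, ?_, ?_⟩
  · simp only [hP5, hw'5]
    refine insert_subset hxF (hwsub.trans (union_subset sdiff_subset ?_))
    exact fun u hu => (hxadj u (hRN' hu)).1
  · intro j hj hmem
    simp only [hP5, hw'5, mem_insert] at hmem
    have hjD := (hfC j hj).1
    rcases hmem with h' | h'
    · exact G.loopless.irrefl x (h' ▸ (hxadj _ (hDN hjD)).2)
    · rcases mem_union.1 (hwsub h') with h' | h'
      · simp [hF', hjD] at h'
      · exact disjoint_left.1 hRD h' hjD
  · intro j hj
    simp only [hP1, hP2, hw'2]
    exact ⟨(hxadj _ (hDN (hfC j hj).1)).2.symm, (hfC j hj).2.symm⟩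

/-- The vertices of a root block. -/
def rootVerts {V β : Type} [DecidableEq V] {G : SimpleGraph V} (J : Finset β)
    (b : BundledWalk G × (β → V)) : Finset V :=
  b.1.verts ∪ J.image b.2

/-- The vertices of a link block. -/
def linkVerts {V β : Type} [DecidableEq V] {G : SimpleGraph V} (I : Finset β)
    (b : V × (β → BundledWalk G)) : Finset V :=
  insert b.1 (I.biUnion fun i => (b.2 i).verts)

lemma IsRootBlock.mono {V β : Type} [DecidableEq V] {G : SimpleGraph V} {s : ℕ}
    {F F' : Finset V} {J : Finset β} {b : BundledWalk G × (β → V)}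
    (h : IsRootBlock G s F J b) (hF : F ⊆ F') : IsRootBlock G s F' J b :=
  { h with
    verts_subset := h.verts_subset.trans hF
    mem := fun j hj => hF (h.mem j hj) }

lemma IsRootBlock.rootVerts_subset {V β : Type} [DecidableEq V] {G : SimpleGraph V} {s : ℕ}
    {F : Finset V} {J : Finset β} {b : BundledWalk G × (β → V)}
    (h : IsRootBlock G s F J b) : rootVerts J b ⊆ F :=
  union_subset h.verts_subset (image_subset_iff.2 h.mem)

lemma IsRootBlock.card_rootVerts_le {V β : Type} [DecidableEq V] {G : SimpleGraph V} {s : ℕ}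
    {F : Finset V} {J : Finset β} {b : BundledWalk G × (β → V)}
    (h : IsRootBlock G s F J b) (hJ : J.card ≤ 60) :
    (rootVerts J b).card ≤ 61 * (s + 1) := by
  have h1 := card_union_le b.1.verts (J.image b.2)
  have h2 := b.1.card_verts_le
  have h3 : (J.image b.2).card ≤ J.card := card_image_le
  rw [h.length_eq] at h2
  unfold rootVerts
  omega

lemma IsLinkBlock.mono {V β : Type} [DecidableEq V] {G : SimpleGraph V} {s : ℕ}
    {F F' : Finset V} {I : Finset β} {a : β → V} {b : V × (β → BundledWalk G)}
    (h : IsLinkBlock G s F I a b) (hF : F ⊆ F') : IsLinkBlock G s F' I a b :=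
  { h with
    mem := hF h.mem
    verts_subset := fun i hi => (h.verts_subset i hi).trans hF }

lemma IsLinkBlock.linkVerts_subset {V β : Type} [DecidableEq V] {G : SimpleGraph V} {s : ℕ}
    {F : Finset V} {I : Finset β} {a : β → V} {b : V × (β → BundledWalk G)}
    (h : IsLinkBlock G s F I a b) : linkVerts I b ⊆ F :=
  insert_subset h.mem (biUnion_subset.2 h.verts_subset)

lemma IsLinkBlock.card_linkVerts_le {V β : Type} [DecidableEq V] {G : SimpleGraph V} {s : ℕ}
    {F : Finset V} {I : Finset β} {a : β → V} {b : V × (β → BundledWalk G)}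
    (h : IsLinkBlock G s F I a b) (hI : I.card ≤ 60) :
    (linkVerts I b).card ≤ 61 * (s + 1) := by
  have h1 := card_insert_le b.1 (I.biUnion fun i => (b.2 i).verts)
  have h2 : (I.biUnion fun i => (b.2 i).verts).card ≤ I.card * (s + 1) :=
    card_biUnion_le_card_mul _ _ _ fun i hi => by
      have := (b.2 i).card_verts_le
      rwa [h.length_eq i hi] at this
  have h3 : I.card * (s + 1) ≤ 60 * (s + 1) := Nat.mul_le_mul_right _ hI
  unfold linkVerts
  omega

lemma degIn_le_add_card {V : Type} [DecidableEq V] (G : SimpleGraph V) [DecidableRel G.Adj]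
    (v : V) (F X : Finset V) : degIn G v F ≤ degIn G v (F \ X) + X.card := by
  unfold degIn
  refine le_trans (card_le_card ?_) (card_union_le _ X)
  intro u hu
  simp only [mem_filter, mem_union, mem_sdiff] at hu ⊢
  tauto

namespace Pseudorandom

variable {V ι β : Type} [DecidableEq V] [DecidableEq ι]
  {G : SimpleGraph V} [DecidableRel G.Adj] {p κ : ℝ} {n s : ℕ}

lemma pos (h : Pseudorandom G p κ n s) : (0 : ℝ) < p * n := by
  have h1 := h.one_le_L
  have h2 := h.large
  have h3 := h.sq_mul_le
  linarith

lemma nonempty (h : Pseudorandom G p κ n s) {F : Finset V}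
    (hF : (n / 16 : ℝ) ≤ F.card) : Nonempty V := by
  have h1 := h.pos
  have h2 := h.mul_le
  have h3 : (0 : ℝ) < F.card := by linarith
  obtain ⟨v, -⟩ := card_pos.1 (by exact_mod_cast h3 : 0 < F.card)
  exact ⟨v⟩

lemma exists_rootBlocks (h : Pseudorandom G p κ n (s + 1)) (hs : 2 ≤ s) (I : Finset ι)
    (J : ι → Finset β) (hJ : ∀ i, (J i).card ≤ 60) (F : Finset V)
    (hF : (n / 16 + I.card * (61 * (s + 1)) : ℝ) ≤ F.card) :
    ∃ f : ι → BundledWalk G × (β → V), (∀ i ∈ I, IsRootBlock G s F (J i) (f i)) ∧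
      ∀ i ∈ I, ∀ i' ∈ I, i ≠ i' → Disjoint (rootVerts (J i) (f i)) (rootVerts (J i') (f i')) := by
  have hF' : (n / 16 : ℝ) ≤ F.card := le_trans (by simp; positivity) hF
  obtain ⟨v⟩ := h.nonempty hF'
  have : Nonempty (BundledWalk G × (β → V)) := ⟨⟨v, v, .nil⟩, fun _ => v⟩
  refine exists_disjoint_family I (fun i b => IsRootBlock G s F (J i) b)
    (fun i b => rootVerts (J i) b) (61 * (s + 1)) (fun i _ b hb => hb.card_rootVerts_le (hJ i))
    fun i _ X hX => ?_
  have h1 := le_card_sdiff X F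
  obtain ⟨b, hb⟩ := h.exists_rootBlock hs (F \ X) (J i) (hJ i) (by
    have h2 : (F.card : ℝ) ≤ (F \ X).card + X.card := by
      exact_mod_cast (by omega : F.card ≤ (F \ X).card + X.card)
    have h3 : (X.card : ℝ) ≤ I.card * (61 * (s + 1)) := by exact_mod_cast hX
    linarith)
  exact ⟨b, hb.mono sdiff_subset, disjoint_of_subset_left hb.rootVerts_subset sdiff_disjoint⟩

lemma exists_linkBlocks [DecidableEq β] (h : Pseudorandom G p κ n (s + 1)) (hs : 2 ≤ s) (N : Finset ι)
    (I : ι → Finset β) (hI : ∀ j, (I j).card ≤ 60) (a : ι → β → V)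
    (ha : ∀ j, ∀ i ∈ I j, ∀ j', ∀ i' ∈ I j', a j i = a j' i' → j = j')
    (U U' : Finset V) (hUU' : Disjoint U U')
    (hU : (n / 16 + N.card * (61 * (s + 1)) : ℝ) ≤ U.card)
    (hU' : (n / 8 : ℝ) ≤ U'.card)
    (hdeg : ∀ j ∈ N, ∀ i ∈ I j, p * U'.card / 2 < degIn G (a j i) U') :
    ∃ g : ι → V × (β → BundledWalk G), (∀ j ∈ N, IsLinkBlock G s (U ∪ U') (I j) (a j) (g j)) ∧
      ∀ j ∈ N, ∀ j' ∈ N, j ≠ j' → Disjoint (linkVerts (I j) (g j)) (linkVerts (I j') (g j')) := by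
  have hp := h.p_pos
  have hpn := h.pos
  have hpn3 := h.mul_le
  have hU0 : (n / 16 : ℝ) ≤ U.card := le_trans (by simp; positivity) hU
  obtain ⟨v⟩ := h.nonempty hU0
  have : Nonempty (V × (β → BundledWalk G)) := ⟨v, fun _ => ⟨v, v, .nil⟩⟩
  obtain ⟨J, hJN, f, hf, hfd, hmax⟩ := exists_maximal_disjoint_family N
    (fun j b => IsLinkBlock G s U (I j) (a j) b) (fun j b => linkVerts (I j) b)
  set X := J.biUnion fun j => linkVerts (I j) (f j)
  have hX : X.card ≤ N.card * (61 * (s + 1)) :=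
    (card_biUnion_le_card_mul _ _ _ fun j hj => (hf j hj).card_linkVerts_le (hI j)).trans
      (Nat.mul_le_mul_right _ (card_le_card hJN))
  have hUX : (n / 16 : ℝ) ≤ (U \ X).card := by
    have h1 := le_card_sdiff X U
    have h2 : (U.card : ℝ) ≤ (U \ X).card + X.card := by
      exact_mod_cast (by omega : U.card ≤ (U \ X).card + X.card)
    have h3 : (X.card : ℝ) ≤ N.card * (61 * (s + 1)) := by exact_mod_cast hX
    linarith
  have hlow : ∀ j ∈ N \ J, ∃ i ∈ I j, (degIn G (a j i) (U \ X) : ℝ) < p * n / 64 := by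
    intro j hj
    by_contra! hno
    obtain ⟨b, hb⟩ := h.exists_linkBlock hs (U \ X) (I j) (a j) (hI j) hUX hno
    exact hmax j hj b (hb.mono sdiff_subset)
      (disjoint_of_subset_left hb.linkVerts_subset sdiff_disjoint)
  have hcard : ((N \ J).card : ℝ) * (3 / 16) ≤ κ * (p * n) := by
    rcases (N \ J).eq_empty_or_nonempty with hNJ | ⟨j₀, hj₀⟩
    · rw [hNJ, card_empty, Nat.cast_zero, zero_mul]
      exact mul_nonneg h.κ_nonneg hpn.le
    obtain ⟨i₀, -, -⟩ := hlow j₀ hj₀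
    have : Nonempty β := ⟨i₀⟩
    choose! i hi hlt using hlow
    have hinj : Set.InjOn (fun j => a j (i j)) (N \ J : Finset ι) := fun j hj j' hj' hjj' =>
      ha j _ (hi j hj) j' _ (hi j' hj') hjj'
    rw [← card_image_of_injOn hinj]
    refine h.card_low_le _ (U \ X) (by norm_num) (by linarith) fun x hx => ?_
    obtain ⟨j, hj, rfl⟩ := mem_image.1 hx
    have := mul_le_mul_of_nonneg_left hUX hp.le
    have := hlt j hj
    linarith
  obtain ⟨g, hg, hgd⟩ := exists_disjoint_family (N \ J)
    (fun j b => IsLinkBlock G s U' (I j) (a j) b) (fun j b => linkVerts (I j) b) (61 * (s + 1))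
    (fun j _ b hb => hb.card_linkVerts_le (hI j)) fun j hj Y hY => by
      have hYpn : (Y.card : ℝ) ≤ p * n / 1000 := by
        have h1 : (Y.card : ℝ) ≤ (N \ J).card * (61 * (s + 1)) := by exact_mod_cast hY
        have h2 := h.κ_le'
        push_cast at h2
        have h3 : ((N \ J).card : ℝ) ≤ 16 / 3 * (κ * (p * n)) := by linarith
        have h4 : (Y.card : ℝ) ≤ 16 / 3 * (κ * (p * n)) * (61 * (s + 1)) :=
          h1.trans (by gcongr)
        nlinarith
      have h1 := le_card_sdiff Y U'
      have h2 : (U'.card : ℝ) ≤ (U' \ Y).card + Y.card := by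
        exact_mod_cast (by omega : U'.card ≤ (U' \ Y).card + Y.card)
      obtain ⟨b, hb⟩ := h.exists_linkBlock hs (U' \ Y) (I j) (a j) (hI j) (by linarith)
        fun i hi => by
          have h3 := hdeg j (mem_sdiff.1 hj).1 i hi
          have h4 : (degIn G (a j i) U' : ℝ) ≤ degIn G (a j i) (U' \ Y) + Y.card := by
            exact_mod_cast degIn_le_add_card G (a j i) U' Y
          have := mul_le_mul_of_nonneg_left hU' hp.le
          linarith
      exact ⟨b, hb.mono sdiff_subset,
        disjoint_of_subset_left hb.linkVerts_subset sdiff_disjoint⟩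
  have hcross : ∀ j ∈ J, ∀ j' ∈ N \ J,
      Disjoint (linkVerts (I j) (f j)) (linkVerts (I j') (g j')) := fun j hj j' hj' =>
    disjoint_of_subset_left (hf j hj).linkVerts_subset
      (disjoint_of_subset_right (hg j' hj').linkVerts_subset hUU')
  refine ⟨fun j => if j ∈ J then f j else g j, fun j hj => ?_, fun j hj j' hj' hne => ?_⟩
  · by_cases hjJ : j ∈ J
    · simpa only [if_pos hjJ] using (hf j hjJ).mono subset_union_left
    · simpa only [if_neg hjJ] using
        (hg j (mem_sdiff.2 ⟨hj, hjJ⟩)).mono subset_union_right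
  · by_cases hjJ : j ∈ J <;> by_cases hjJ' : j' ∈ J
    · simpa only [if_pos hjJ, if_pos hjJ'] using hfd j hjJ j' hjJ' hne
    · simpa only [if_pos hjJ, if_neg hjJ'] using hcross j hjJ j' (mem_sdiff.2 ⟨hj', hjJ'⟩)
    · simpa only [if_neg hjJ, if_pos hjJ'] using
        (hcross j' hjJ' j (mem_sdiff.2 ⟨hj, hjJ⟩)).symm
    · simpa only [if_neg hjJ, if_neg hjJ'] using
        hgd j (mem_sdiff.2 ⟨hj, hjJ⟩) j' (mem_sdiff.2 ⟨hj', hjJ'⟩) hne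

end Pseudorandom

/-- Root blocks and link blocks along the edges of a template form an absorbing structure. -/
lemma exists_absorbingStructure_of_blocks {V : Type} [Fintype V] [DecidableEq V]
    {G : SimpleGraph V} {s m : ℕ} (T : Finset (Fin (3 * m) × Fin (4 * m)))
    (hT : ∀ Jbar : Finset (Fin (4 * m)), (∀ j ∈ Jbar, (j : ℕ) < 2 * m) → Jbar.card = m →
      ∃ f : Fin (3 * m) → Fin (4 * m), Function.Injective f ∧ ∀ i, (i, f i) ∈ T ∧ f i ∉ Jbar)
    {F U : Finset V} (hFU : Disjoint F U)
    (f : Fin (3 * m) → BundledWalk G × (Fin (4 * m) → V))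
    (hf : ∀ i, IsRootBlock G s F (univ.filter fun j => (i, j) ∈ T) (f i))
    (hfd : ∀ i i', i ≠ i' → Disjoint (rootVerts (univ.filter fun j => (i, j) ∈ T) (f i))
      (rootVerts (univ.filter fun j => (i', j) ∈ T) (f i')))
    (g : Fin (4 * m) → V × (Fin (3 * m) → BundledWalk G))
    (hg : ∀ j, IsLinkBlock G s U (univ.filter fun i => (i, j) ∈ T) (fun i => (f i).2 j) (g j))
    (hgd : ∀ j j', j ≠ j' → Disjoint (linkVerts (univ.filter fun i => (i, j) ∈ T) (g j))
      (linkVerts (univ.filter fun i => (i, j') ∈ T) (g j'))) :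
    ∃ S : AbsorbingStructure G s m, S.T = T ∧ S.verts ⊆ F ∪ U := by
  have hJ : ∀ {e}, e ∈ T → e.2 ∈ univ.filter fun j => (e.1, j) ∈ T := fun he => by simpa using he
  have hI : ∀ {e}, e ∈ T → e.1 ∈ univ.filter fun i => (i, e.2) ∈ T := fun he => by simpa using he
  have hverts : ∀ i, (f i).1.verts ⊆ rootVerts (univ.filter fun j => (i, j) ∈ T) (f i) :=
    fun i => subset_union_left
  have ha : ∀ {e}, e ∈ T →
      (f e.1).2 e.2 ∈ rootVerts (univ.filter fun j => (e.1, j) ∈ T) (f e.1) := fun he =>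
    mem_union_right _ (mem_image_of_mem _ (hJ he))
  have hz : ∀ j, (g j).1 ∈ linkVerts (univ.filter fun i => (i, j) ∈ T) (g j) :=
    fun j => mem_insert_self _ _
  have hlink : ∀ {e}, e ∈ T →
      ((g e.2).2 e.1).verts ⊆ linkVerts (univ.filter fun i => (i, e.2) ∈ T) (g e.2) := fun he =>
    (subset_biUnion_of_mem (fun i => ((g _).2 i).verts) (hI he)).trans (subset_insert _ _)
  have hP1F : (univ.biUnion fun i => (f i).1.verts) ⊆ F :=
    biUnion_subset.2 fun i _ => (hf i).verts_subset
  have hP2U : (T.biUnion fun e => ((g e.2).2 e.1).verts) ⊆ U :=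
    biUnion_subset.2 fun e he => (hg e.2).verts_subset _ (hI he)
  have haF : (T.image fun e => (f e.1).2 e.2) ⊆ F :=
    image_subset_iff.2 fun e he => (hf e.1).mem _ (hJ he)
  have hzU : (univ.image fun j => (g j).1) ⊆ U := image_subset_iff.2 fun j _ => (hg j).mem
  have hFU' : ∀ {A B : Finset V}, A ⊆ F → B ⊆ U → Disjoint A B := fun hA hB =>
    disjoint_of_subset_left hA (disjoint_of_subset_right hB hFU)
  have hP1a : Disjoint (univ.biUnion fun i => (f i).1.verts) (T.image fun e => (f e.1).2 e.2) := by
    rw [disjoint_biUnion_left]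
    intro i _
    rw [disjoint_right]
    intro x hx
    obtain ⟨e, he, rfl⟩ := mem_image.1 hx
    by_cases hie : i = e.1
    · subst hie
      exact (hf e.1).notMem_verts _ (hJ he)
    · exact fun hmem => disjoint_left.1 (hfd i e.1 hie) (hverts i hmem) (ha he)
  have hP2z : Disjoint (T.biUnion fun e => ((g e.2).2 e.1).verts) (univ.image fun j => (g j).1) := by
    rw [disjoint_biUnion_left]
    intro e he
    rw [disjoint_right]
    intro x hx
    obtain ⟨j, -, rfl⟩ := mem_image.1 hx
    by_cases hje : e.2 = j
    · subst hje
      exact (hg e.2).notMem_verts _ (hI he)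
    · exact fun hmem => disjoint_left.1 (hgd e.2 j hje) (hlink he hmem) (hz j)
  refine ⟨{
    T := T
    template := hT
    pA := fun i => (f i).1.fst
    pB := fun i => (f i).1.snd
    P1 := fun i => (f i).1.walk
    P1_path := fun i => (hf i).isPath
    P1_len := fun i => (hf i).length_eq
    qA := fun e => ((g e.2).2 e.1).fst
    qB := fun e => ((g e.2).2 e.1).snd
    P2 := fun e => ((g e.2).2 e.1).walk
    P2_path := fun e he => (hg e.2).isPath _ (hI he)
    P2_len := fun e he => (hg e.2).length_eq _ (hI he)
    a := fun e => (f e.1).2 e.2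
    z := fun j => (g j).1
    P1_disj := fun i j hij =>
      disjoint_of_subset_left (hverts i) (disjoint_of_subset_right (hverts j) (hfd i j hij))
    P2_disj := fun e he e' he' hee' => ?_
    a_inj := fun e he e' he' hee' => ?_
    z_inj := fun j j' hjj' => ?_
    global_disj := ?_
    adj_a_P1 := fun e he => (hf e.1).adj _ (hJ he)
    adj_a_P2 := fun e he => (hg e.2).adj_left _ (hI he)
    adj_z_P2 := fun e he => (hg e.2).adj_right _ (hI he) }, rfl, ?_⟩
  · by_cases h2 : e.2 = e'.2
    · have h1 : e.1 ≠ e'.1 := fun h1 => hee' (Prod.ext h1 h2)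
      have := (hg e.2).disjoint _ (hI he) e'.1 (by simpa [h2] using he') h1
      rwa [h2] at this ⊢
    · exact disjoint_of_subset_left (hlink he)
        (disjoint_of_subset_right (hlink he') (hgd _ _ h2))
  · have h1 : e.1 = e'.1 := by
      by_contra h1
      refine disjoint_left.1 (hfd _ _ h1) (ha he) ?_
      have := ha he'
      rwa [← hee'] at this
    refine Prod.ext h1 ((hf e.1).injOn (mem_coe.2 (hJ he)) ?_ ?_)
    · simpa [h1] using he'
    · simpa only [h1] using hee'
  · by_contra hne
    refine disjoint_left.1 (hgd _ _ hne) (hz j) ?_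
    simp only at hjj'
    rw [hjj']
    exact hz j'
  · simp only [List.pairwise_cons, List.mem_cons, List.not_mem_nil, or_false, forall_eq_or_imp,
      forall_eq, IsEmpty.forall_iff, implies_true, List.Pairwise.nil, and_true]
    exact ⟨⟨hFU' hP1F hP2U, hP1a, hFU' hP1F hzU⟩, ⟨(hFU' haF hP2U).symm, hP2z⟩, hFU' haF hzU⟩
  · unfold AbsorbingStructure.verts
    refine union_subset (union_subset (union_subset ?_ ?_) ?_) ?_
    · exact hP1F.trans subset_union_left
    · exact hP2U.trans subset_union_right
    · exact haF.trans subset_union_left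
    · exact hzU.trans subset_union_right

lemma Pseudorandom.exists_absorbingStructure {V : Type} [Fintype V] [DecidableEq V]
    {G : SimpleGraph V} [DecidableRel G.Adj] {p κ : ℝ} {n s m : ℕ}
    (h : Pseudorandom G p κ n (s + 1)) (hs : 2 ≤ s) (hV : Fintype.card V = n)
    (hm : (m * (s + 1) * 10 ^ 4 : ℝ) ≤ n) (W : Finset V) (hW : W.card ≤ n / 4) :
    ∃ S : AbsorbingStructure G s m,
      (∀ i, (S.T.filter fun e => e.1 = i).card ≤ 60) ∧
      (∀ j, (S.T.filter fun e => e.2 = j).card ≤ 60) ∧ Disjoint W S.verts := by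
  have hp := h.p_pos
  have hpn := h.pos
  have hpn3 := h.mul_le
  have hn : 100 ≤ n := by
    have h1 := h.one_le_L
    have h2 := h.large
    have h3 := h.sq_mul_le
    have : (100 : ℝ) ≤ n := by linarith
    exact_mod_cast this
  obtain ⟨T, hT1, hT2, hT⟩ := exists_template m
  have hWc : Wᶜ.card = n - W.card := by rw [card_compl, hV]
  obtain ⟨F, hFW, hF⟩ := exists_subset_card_eq (show n / 8 + 1 ≤ Wᶜ.card by omega)
  have hFc : (Wᶜ \ F).card = n - W.card - (n / 8 + 1) := by
    rw [card_sdiff_of_subset hFW, hWc, hF]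
  obtain ⟨U, hUW, hU⟩ := exists_subset_card_eq (show n / 8 + 1 ≤ (Wᶜ \ F).card by omega)
  have hUc : ((Wᶜ \ F) \ U).card = n - W.card - (n / 8 + 1) - (n / 8 + 1) := by
    rw [card_sdiff_of_subset hUW, hFc, hU]
  obtain ⟨U', hUW', hU'⟩ := exists_subset_card_eq
    (show n / 8 + 1 ≤ ((Wᶜ \ F) \ U).card by omega)
  have hn8 : (n / 8 : ℝ) ≤ (n / 8 + 1 : ℕ) := by
    rw [div_le_iff₀ (by norm_num)]
    exact_mod_cast (by omega : n ≤ (n / 8 + 1) * 8)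
  have hUU' : Disjoint U U' := disjoint_of_subset_right hUW' disjoint_sdiff
  have hFU : Disjoint F (U ∪ U') := disjoint_of_subset_right
    (union_subset hUW (hUW'.trans sdiff_subset)) disjoint_sdiff
  have hFW' : F ∪ (U ∪ U') ⊆ Wᶜ := union_subset hFW
    ((union_subset hUW (hUW'.trans sdiff_subset)).trans sdiff_subset)
  set Bad := F.filter fun v => (degIn G v U' : ℝ) ≤ p * U'.card / 2
  have hBadcard : (Bad.card : ℝ) ≤ n / 1000 := by
    have h1 := h.card_low_le Bad U' (c := 3 / 8) (by norm_num)
      (by rw [hU']; linarith) fun v hv => (mem_filter.1 hv).2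
    have h2 := h.κ_le_const
    nlinarith
  have hFB : (n / 8 - n / 1000 : ℝ) ≤ (F \ Bad).card := by
    have h1 := le_card_sdiff Bad F
    have h2 : (F.card : ℝ) ≤ (F \ Bad).card + Bad.card := by
      exact_mod_cast (by omega : F.card ≤ (F \ Bad).card + Bad.card)
    rw [hF] at h2
    linarith
  obtain ⟨f, hf, hfd⟩ := h.exists_rootBlocks hs univ
    (fun i => univ.filter fun j => (i, j) ∈ T) hT1 (F \ Bad) (by
      rw [card_univ, Fintype.card_fin]
      push_cast
      linarith)
  simp only [mem_univ, true_implies] at hf hfd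
  have hamem : ∀ i j, (i, j) ∈ T →
      (f i).2 j ∈ rootVerts (univ.filter fun j => (i, j) ∈ T) (f i) := fun i j hij =>
    mem_union_right _ (mem_image_of_mem _ (by simpa using hij))
  obtain ⟨g, hg, hgd⟩ := h.exists_linkBlocks hs univ
    (fun j => univ.filter fun i => (i, j) ∈ T) hT2 (fun j i => (f i).2 j)
    (by
      intro j i hi j' i' hi' hjj'
      simp only [mem_filter, mem_univ, true_and] at hi hi'
      have hii' : i = i' := by
        by_contra hne
        refine disjoint_left.1 (hfd _ _ hne) (hamem i j hi) ?_
        rw [hjj']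
        exact hamem i' j' hi'
      subst hii'
      exact (hf i).injOn (by simpa using hi) (by simpa using hi') hjj')
    U U' hUU'
    (by
      rw [card_univ, Fintype.card_fin, hU]
      push_cast at hn8 ⊢
      linarith)
    (by rw [hU']; exact hn8)
    (by
      intro j _ i hi
      have h1 := mem_sdiff.1 ((hf i).mem j (by simpa using hi))
      by_contra! hlow
      exact h1.2 (mem_filter.2 ⟨h1.1, hlow⟩))
  simp only [mem_univ, true_implies] at hg hgd
  obtain ⟨S, rfl, hS⟩ := exists_absorbingStructure_of_blocks T hT hFU f
    (fun i => (hf i).mono sdiff_subset) hfd g hg hgd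
  refine ⟨S, fun i => le_trans ?_ (hT1 i), fun j => le_trans ?_ (hT2 j), ?_⟩
  · refine card_le_card_of_injOn Prod.snd ?_ ?_
    · rintro ⟨i', j⟩ he
      simp only [coe_filter, Set.mem_ofPred_eq] at he
      simpa [← he.2] using he.1
    · rintro ⟨i₁, j₁⟩ h1 ⟨i₂, j₂⟩ h2 h12
      simp only [coe_filter, Set.mem_ofPred_eq] at h1 h2 h12
      rw [h1.2, h2.2, h12]
  · refine card_le_card_of_injOn Prod.fst ?_ ?_
    · rintro ⟨i, j'⟩ he
      simp only [coe_filter, Set.mem_ofPred_eq] at he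
      simpa [← he.2] using he.1
    · rintro ⟨i₁, j₁⟩ h1 ⟨i₂, j₂⟩ h2 h12
      simp only [coe_filter, Set.mem_ofPred_eq] at h1 h2 h12
      rw [h1.2, h2.2, h12]
  · exact (disjoint_of_subset_left (hS.trans hFW') disjoint_compl_left).symm

/-- with `K = 68042`, for every `δ > 0`, `ℓ ≥ 4` and
`α ∈ (0, 1/(60ℓ(K+2))]` there is `ε₀ > 0` such that for every `ε ∈ (0,ε₀)` there is
`n₀` such that for all `n ≥ n₀` the following holds: every `(p,λ)`-bijumbled graph `G`
on `n` vertices with `p ∈ (0,1/3]`, `λ ≤ ε p² n` and minimum degree at least `δ p n`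
contains an absorbing structure `S` for cycles of length `ℓ` with flexibility
`m = ⌊αn⌋` whose template has maximum degree at most `K`; moreover there is a set
`W ⊆ V(G) ∖ V(S)` of size `n/4` with `deg(v,W) ≥ δ p |W|/8` for every vertex `v`. -/
theorem stmt18 (δ : ℝ) (hδ : 0 < δ) (ℓ : ℕ) (hℓ : 4 ≤ ℓ) (α : ℝ) (hα : 0 < α)
    (hα' : α ≤ 1 / (60 * ℓ * (68042 + 2) : ℝ)) :
    ∃ ε₀ : ℝ, 0 < ε₀ ∧ ∀ ε : ℝ, 0 < ε → ε < ε₀ → ∃ n₀ : ℕ, ∀ n : ℕ, n₀ ≤ n →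
    ∀ (V : Type) [Fintype V] [DecidableEq V] (G : SimpleGraph V) [DecidableRel G.Adj],
      Fintype.card V = n →
      ∀ p lam : ℝ, 0 < p → p ≤ 1 / 3 → lam ≤ ε * p ^ 2 * n → Bijumbled G p lam →
      (∀ v : V, δ * p * n ≤ (G.degree v : ℝ)) →
      ∀ m : ℕ, m = ⌊α * n⌋₊ →
      ∃ S : AbsorbingStructure G (ℓ - 2) m,
        (∀ i : Fin (3 * m), (S.T.filter fun e => e.1 = i).card ≤ 68042) ∧
        (∀ j : Fin (4 * m), (S.T.filter fun e => e.2 = j).card ≤ 68042) ∧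
        ∃ W : Finset V, Disjoint W S.verts ∧ W.card = n / 4 ∧
          ∀ v : V, δ * p * W.card / 8 ≤ (degIn G v W : ℝ) := by
  obtain ⟨s, rfl⟩ := Nat.exists_eq_add_of_le' (show 2 ≤ ℓ by omega)
  have hs : 2 ≤ s := by omega
  have hL : (1 : ℝ) ≤ (s + 1 : ℕ) := by exact_mod_cast Nat.le_add_left 1 s
  set L : ℝ := ((s + 1 : ℕ) : ℝ)
  have hL0 : 0 < L := by linarith
  obtain ⟨n₀, hn₀⟩ := exists_mul_exp_neg_sqrt_lt (δ / 32) (by positivity)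
  refine ⟨min (1 / (10 ^ 4 * L)) (√δ / (10 ^ 4 * L)), by positivity, fun ε hε hε₀ => ⟨n₀, ?_⟩⟩
  intro n hn V _ _ G _ hV p lam hp hp3 hlam hG hdeg m hm
  obtain ⟨hn1, hsmall⟩ := hn₀ n hn
  have hn0 : (0 : ℝ) < n := by exact_mod_cast hn1
  have hε1 : ε * (10 ^ 4 * L) ≤ 1 :=
    (le_div_iff₀ (by positivity)).1 (hε₀.le.trans (min_le_left _ _))
  have hε2 : ε * (10 ^ 4 * L) ≤ √δ :=
    (le_div_iff₀ (by positivity)).1 (hε₀.le.trans (min_le_right _ _))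
  have hε1' : (ε * (10 ^ 4 * L)) ^ 2 ≤ 1 := pow_le_one₀ (by positivity) hε1
  have hε2' : (ε * (10 ^ 4 * L)) ^ 2 ≤ δ := by
    rw [← Real.sq_sqrt hδ.le]
    gcongr
  obtain ⟨v⟩ := Fintype.card_pos_iff.1 (show 0 < Fintype.card V by omega)
  have hp3n := hG.le_pow_three_mul hp hp3 hδ hn0 hlam v (hdeg v)
  have hlarge : 10 ^ 6 * L ≤ p ^ 2 * n := by
    have h1 : 9 * ε ^ 2 * (10 ^ 6 * L) ≤ 9 * ε ^ 2 * (p ^ 3 * n) := by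
      refine le_trans ?_ hp3n
      have : ε ^ 2 * L ≤ ε ^ 2 * L ^ 2 := by
        gcongr
        nlinarith
      nlinarith
    have h2 : 10 ^ 6 * L ≤ p ^ 3 * n := le_of_mul_le_mul_left h1 (by positivity)
    refine h2.trans ?_
    gcongr ?_ * _
    exact pow_le_pow_of_le_one hp.le (by linarith) (by norm_num)
  have hps : Pseudorandom G p (4 * ε ^ 2) n (s + 1) :=
    { p_pos := hp
      p_le := hp3
      κ_nonneg := by positivity
      L_pos := by omega
      κ_le := by nlinarith
      large := hlarge
      typical := hG.typicalDegrees hp hε.le hn0.le hlam }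
  have hsqrt : √(n : ℝ) ≤ p * n := by
    rw [Real.sqrt_le_iff]
    refine ⟨by positivity, ?_⟩
    have : 1 * (n : ℝ) ≤ p ^ 2 * n * n := by
      gcongr
      linarith
    linarith
  obtain ⟨W, hWcard, hW⟩ := exists_subset_card_div_four G hV (d := δ * p * n)
    (lt_of_le_of_lt (by
      gcongr
      calc δ / 32 * √(n : ℝ) ≤ δ / 32 * (p * n) := by gcongr
        _ = _ := by ring) hsmall) hdeg
  have hmn : (m * (s + 1) * 10 ^ 4 : ℝ) ≤ n := by
    have h1 : (m : ℝ) ≤ α * n := by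
      rw [hm]
      exact Nat.floor_le (by positivity)
    have h2 : α * (60 * (s + 2 : ℕ) * (68042 + 2)) ≤ 1 :=
      (le_div_iff₀ (by positivity)).1 hα'
    push_cast at h2
    have h3 : α * ((s + 1) * 10 ^ 4) ≤ 1 := by nlinarith
    calc (m * (s + 1) * 10 ^ 4 : ℝ) = m * ((s + 1) * 10 ^ 4) := by ring
      _ ≤ α * n * ((s + 1) * 10 ^ 4) := by gcongr
      _ = α * ((s + 1) * 10 ^ 4) * n := by ring
      _ ≤ 1 * n := by gcongr
      _ = n := one_mul _
  obtain ⟨S, hS1, hS2, hSW⟩ := hps.exists_absorbingStructure hs hV hmn W hWcard.le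
  refine ⟨S, fun i => (hS1 i).trans (by norm_num), fun j => (hS2 j).trans (by norm_num),
    W, hSW, hWcard, fun v => le_trans ?_ (hW v)⟩
  have hWn : (W.card : ℝ) ≤ n / 4 := by
    rw [hWcard]
    exact Nat.cast_div_le
  have : δ * p * W.card ≤ δ * p * (n / 4) := by gcongr
  linarith
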